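/- arXiv:1610.06935 — 2 statements merged into one kernel-verified Lean document; each statement's English description precedes it below -/
import Mathlib

section
/- Let K = ℚ(√2) with O_K = ℤ[√2]. For every totally positive m ∈ O_K that is locally represented by the sum of four squares, the representation number satisfies r_Q(m) = 8·Σ_{(0)≠(d)|(m)} N(d) − 6·Σ_{(2)|(d)|(m)} N(d) + 4·Σ_{(4)|(d)|(m)} N(d). -/
open NumberField Ideal

/-- The ring `ℤ[√2]`. -/
abbrev Zs := Zsqrtd 2

namespace FourSq

/-- The element `√2`. -/
def s : Zs := ⟨0, 1⟩

lemma s_mul : s * s = 2 := by ext <;> simp [s]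

lemma nonsq : ∀ n : ℤ, (2 : ℤ) ≠ n * n := by
  intro n h
  have h1 : n < 2 := by nlinarith
  have h2 : -2 < n := by nlinarith
  interval_cases n <;> omega

lemma norm_eq0 {x : Zs} : x.norm = 0 ↔ x = 0 := Zsqrtd.norm_eq_zero nonsq x

lemma norm_def' (x : Zs) : x.norm = x.re ^ 2 - 2 * x.im ^ 2 := by
  rw [Zsqrtd.norm_def]; ring

instance : IsDomain Zs := by
  have : NoZeroDivisors Zs := ⟨by
    intro a b h
    have := congrArg Zsqrtd.norm h
    rw [Zsqrtd.norm_mul] at this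
    simp only [Zsqrtd.norm_zero] at this
    rcases mul_eq_zero.1 this with h | h
    · exact Or.inl (norm_eq0.1 h)
    · exact Or.inr (norm_eq0.1 h)⟩
  exact NoZeroDivisors.to_isDomain _

lemma s_ne : s ≠ 0 := by
  intro h; have := congrArg Zsqrtd.im h; simp [s] at this

lemma two_ne : (2 : Zs) ≠ 0 := by
  rw [← s_mul]; exact mul_ne_zero s_ne s_ne

lemma round (t M : ℤ) (hM : 0 < M) : ∃ k : ℤ, 2 * |t - M * k| ≤ M := by
  refine ⟨(2 * t + M) / (2 * M), ?_⟩
  have h1 := Int.emod_add_mul_ediv (2 * t + M) (2 * M)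
  have h2 := Int.emod_nonneg (2 * t + M) (show 2 * M ≠ 0 by omega)
  have h3 := Int.emod_lt_of_pos (2 * t + M) (show 0 < 2 * M by omega)
  rw [← abs_two, ← abs_mul, abs_le, abs_two]
  constructor <;> nlinarith

lemma exists_quot (x y : Zs) (hy : y ≠ 0) :
    ∃ q : Zs, (x - y * q).norm.natAbs < y.norm.natAbs := by
  have hn : y.norm ≠ 0 := fun h => hy (norm_eq0.1 h)
  -- multiply by the conjugate and sign
  obtain ⟨w, M, hM, hw⟩ : ∃ (w : Zs) (M : ℤ), 0 < M ∧ y * w = (M : Zs) := by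
    rcases lt_or_gt_of_ne hn with h | h
    · refine ⟨-star y, -y.norm, by omega, ?_⟩
      have := Zsqrtd.norm_eq_mul_conj y
      push_cast; rw [this]; ring
    · refine ⟨star y, y.norm, by omega, ?_⟩
      have := Zsqrtd.norm_eq_mul_conj y
      rw [this]
  obtain ⟨k, hk⟩ := round (x * w).re M hM
  obtain ⟨l, hl⟩ := round (x * w).im M hM
  refine ⟨⟨k, l⟩, ?_⟩
  set q : Zs := ⟨k, l⟩
  have e1 : (x - y * q) * w = x * w - (M : Zs) * q := by rw [← hw]; ring
  have e2 : ((x - y * q) * w).norm = ((x * w).re - M * k) ^ 2 - 2 * ((x * w).im - M * l) ^ 2 := by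
    rw [e1, norm_def']; simp [q]
  have e3 : ((x - y * q) * w).norm.natAbs < (y * w).norm.natAbs := by
    zify
    rw [e2, hw]
    have : ((M : Zs)).norm = M * M := Zsqrtd.norm_intCast _
    rw [this, abs_of_pos (by positivity : 0 < M * M), abs_lt]
    have a1 : 4 * ((x * w).re - M * k) ^ 2 ≤ M ^ 2 := by
      rw [← sq_abs]; nlinarith [abs_nonneg ((x * w).re - M * k)]
    have a2 : 4 * ((x * w).im - M * l) ^ 2 ≤ M ^ 2 := by
      rw [← sq_abs]; nlinarith [abs_nonneg ((x * w).im - M * l)]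
    constructor <;> nlinarith [sq_nonneg ((x * w).re - M * k), sq_nonneg ((x * w).im - M * l)]
  rw [Zsqrtd.norm_mul, Zsqrtd.norm_mul, Int.natAbs_mul, Int.natAbs_mul] at e3
  exact lt_of_mul_lt_mul_right e3 (Nat.zero_le _)

theorem isPIR : IsPrincipalIdealRing Zs := by
  classical
  let E : EuclideanDomain Zs :=
    { (inferInstance : CommRing Zs), (inferInstance : Nontrivial Zs) with
      quotient := fun x y => if h : y = 0 then 0 else (exists_quot x y h).choose
      quotient_zero := by intro a; simp
      remainder := fun x y => x - y * (if h : y = 0 then 0 else (exists_quot x y h).choose)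
      quotient_mul_add_remainder_eq := by intro a b; ring
      r := fun x y => x.norm.natAbs < y.norm.natAbs
      r_wellFounded := (measure fun x : Zs => x.norm.natAbs).wf
      remainder_lt := by
        intro a b hb
        rw [dif_neg hb]
        exact (exists_quot a b hb).choose_spec
      mul_left_not_lt := by
        intro a b hb
        have : b.norm.natAbs ≠ 0 := by
          intro h; exact hb (norm_eq0.1 (Int.natAbs_eq_zero.1 h))
        rw [Zsqrtd.norm_mul, Int.natAbs_mul]
        have : 1 ≤ b.norm.natAbs := by omega
        nlinarith [Nat.zero_le a.norm.natAbs] }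
  exact @EuclideanDomain.to_principal_ideal_domain Zs E

instance : IsPrincipalIdealRing Zs := isPIR

/-- Totally positive elements. -/
def TP (m : Zs) : Prop := 0 < m.re ∧ 0 < m.norm

lemma TP.ne {m : Zs} (h : TP m) : m ≠ 0 := by
  rintro rfl; simpa using h.1

lemma TP.add {m n : Zs} (hm : TP m) (hn : TP n) : TP (m + n) := by
  obtain ⟨h1, h2⟩ := hm
  obtain ⟨h3, h4⟩ := hn
  rw [norm_def'] at h2 h4
  refine ⟨by simp; omega, ?_⟩
  rw [norm_def']
  simp only [Zsqrtd.re_add, Zsqrtd.im_add]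
  have : 2 * (m.im * n.im) < m.re * n.re := by
    apply lt_of_pow_lt_pow_left₀ 2 (by positivity)
    nlinarith [sq_nonneg m.im, sq_nonneg n.im, mul_pos h2 h4, mul_nonneg (sq_nonneg m.im) h4.le, mul_nonneg (sq_nonneg n.im) h2.le]
  nlinarith

lemma TP.mul {m n : Zs} (hm : TP m) (hn : TP n) : TP (m * n) := by
  obtain ⟨h1, h2⟩ := hm
  obtain ⟨h3, h4⟩ := hn
  refine ⟨?_, by rw [Zsqrtd.norm_mul]; positivity⟩
  rw [norm_def'] at h2 h4
  simp only [Zsqrtd.re_mul]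
  have : -(2 * (m.im * n.im)) < m.re * n.re := by
    apply lt_of_pow_lt_pow_left₀ 2 (by positivity)
    nlinarith [sq_nonneg m.im, sq_nonneg n.im, mul_pos h2 h4, mul_nonneg (sq_nonneg m.im) h4.le, mul_nonneg (sq_nonneg n.im) h2.le]
  nlinarith

lemma TP_or_neg {m : Zs} (h : 0 < m.norm) : TP m ∨ TP (-m) := by
  have : m.re ≠ 0 := by
    intro h0; rw [norm_def', h0] at h; nlinarith [sq_nonneg m.im]
  rcases lt_or_gt_of_ne this with h1 | h1
  · exact Or.inr ⟨by simp; omega, by rwa [Zsqrtd.norm_neg]⟩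
  · exact Or.inl ⟨h1, h⟩

lemma TP.not_neg {m : Zs} (h : TP m) : ¬ TP (-m) := by
  intro h'; have := h.1; have := h'.1; simp at this; omega

lemma TP.of_mul {m n : Zs} (hmn : TP (m * n)) (hn : TP n) : TP m := by
  have h := hmn.2
  rw [Zsqrtd.norm_mul] at h
  have h1 : 0 < m.norm := pos_of_mul_pos_left h hn.2.le
  rcases TP_or_neg h1 with h2 | h2
  · exact h2
  · exact absurd (by simpa using h2.mul hn) hmn.not_neg

lemma TP_sq {m : Zs} (h : m ≠ 0) : TP (m * m) := by
  have hn : m.norm ≠ 0 := fun h' => h (norm_eq0.1 h')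
  refine ⟨?_, by rw [Zsqrtd.norm_mul]; exact mul_self_pos.2 hn⟩
  simp only [Zsqrtd.re_mul]
  by_contra hc
  apply h
  have h1 : m.re = 0 := by nlinarith [sq_nonneg m.re, sq_nonneg m.im]
  have h2 : m.im = 0 := by nlinarith [sq_nonneg m.re, sq_nonneg m.im]
  ext <;> simp [h1, h2]

lemma TP_one : TP 1 := by constructor <;> simp

lemma isUnit_iff' {m : Zs} : IsUnit m ↔ m.norm.natAbs = 1 := Zsqrtd.norm_eq_one_iff.symm

/-- A nonzero element has a totally positive associate. -/
lemma exists_TP {m : Zs} (h : m ≠ 0) : ∃ u : Zs, IsUnit u ∧ TP (m * u) := by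
  have hn : m.norm ≠ 0 := fun h' => h (norm_eq0.1 h')
  rcases lt_or_gt_of_ne hn with h1 | h1
  · have h2 : 0 < (m * ⟨1, 1⟩ : Zs).norm := by
      rw [Zsqrtd.norm_mul, norm_def' ⟨1, 1⟩]; simp; omega
    rcases TP_or_neg h2 with h3 | h3
    · exact ⟨⟨1, 1⟩, by rw [isUnit_iff', norm_def']; simp, h3⟩
    · exact ⟨-⟨1, 1⟩, by rw [isUnit_iff', Zsqrtd.norm_neg, norm_def']; simp, by simpa using h3⟩
  · rcases TP_or_neg h1 with h3 | h3
    · exact ⟨1, isUnit_one, by simpa using h3⟩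
    · exact ⟨-1, by simp, by simpa using h3⟩

/-- Totally positive units are squares. -/
lemma unit_sq {m : Zs} (hm : TP m) (hu : IsUnit m) : ∃ d : Zs, IsUnit d ∧ m = d * d := by
  suffices ∃ d : Zs, m = d * d by
    obtain ⟨d, hd⟩ := this
    refine ⟨d, ?_, hd⟩
    rw [hd] at hu
    exact isUnit_of_mul_isUnit_left hu
  have h1 : m.re ^ 2 - 2 * m.im ^ 2 = 1 := by
    rw [← norm_def']
    have := isUnit_iff'.1 hu
    have := hm.2
    omega
  have hpos := hm.1
  set a := m.re with ha
  set b := m.im with hb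
  have ha2 : a % 2 = 1 := by
    rcases Int.even_or_odd' a with ⟨t, ht | ht⟩
    · exfalso; rw [ht] at h1
      have : 2 * (2 * t ^ 2 - b ^ 2) = 1 := by linarith
      omega
    · omega
  obtain ⟨t, ht⟩ : ∃ t, a = 2 * t + 1 := ⟨a / 2, by omega⟩
  have h2 : b ^ 2 = 2 * (t * (t + 1)) := by rw [ht] at h1; linarith
  have hb2 : 2 ∣ b := by
    have : (2 : ℤ) ∣ b ^ 2 := ⟨_, h2⟩
    exact Int.prime_two.dvd_of_dvd_pow this
  obtain ⟨c, hc⟩ := hb2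
  have h3 : t * (t + 1) = 2 * c ^ 2 := by rw [hc] at h2; linarith
  have ht0 : 0 ≤ t := by omega
  have key : ∃ x y : ℤ, x ^ 2 + 2 * y ^ 2 = a ∧ 2 * (x * y) = b := by
    suffices ∃ x y : ℤ, x ^ 2 + 2 * y ^ 2 = a ∧ (x * y) ^ 2 = c ^ 2 by
      obtain ⟨x, y, hx, hy⟩ := this
      rcases sq_eq_sq_iff_eq_or_eq_neg.1 hy with h | h
      · exact ⟨x, y, hx, by rw [hc, h]⟩
      · exact ⟨x, -y, by rw [neg_sq, hx], by rw [hc]; linarith⟩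
    rcases Int.even_or_odd' t with ⟨z, hz | hz⟩
    · have h4 : z * (t + 1) = c ^ 2 := by
        have : 2 * (z * (t + 1)) = 2 * c ^ 2 := by rw [← h3, hz]; ring
        linarith
      have hcop : IsCoprime z (t + 1) := ⟨-2, 1, by rw [hz]; ring⟩
      obtain ⟨y, hy⟩ := Int.sq_of_isCoprime hcop h4
      obtain ⟨x, hx⟩ := Int.sq_of_isCoprime hcop.symm (by rw [mul_comm]; exact h4)
      have hy' : z = y ^ 2 := by rcases hy with h | h <;> nlinarith [sq_nonneg y]
      have hx' : t + 1 = x ^ 2 := by rcases hx with h | h <;> nlinarith [sq_nonneg x]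
      exact ⟨x, y, by rw [← hy', ← hx', ht]; omega, by rw [mul_pow, ← hx', ← hy', ← h4]; ring⟩
    · have h4 : t * (z + 1) = c ^ 2 := by
        have : 2 * (t * (z + 1)) = 2 * c ^ 2 := by rw [← h3, hz]; ring
        linarith
      have hcop : IsCoprime t (z + 1) := ⟨-1, 2, by rw [hz]; ring⟩
      obtain ⟨x, hx⟩ := Int.sq_of_isCoprime hcop h4
      obtain ⟨y, hy⟩ := Int.sq_of_isCoprime hcop.symm (by rw [mul_comm]; exact h4)
      have hy' : z + 1 = y ^ 2 := by rcases hy with h | h <;> nlinarith [sq_nonneg y]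
      have hx' : t = x ^ 2 := by rcases hx with h | h <;> nlinarith [sq_nonneg x]
      exact ⟨x, y, by rw [← hy', ← hx', ht]; omega, by rw [mul_pow, ← hx', ← hy', ← h4]⟩
  obtain ⟨x, y, hx, hy⟩ := key
  refine ⟨⟨x, y⟩, ?_⟩
  ext
  · simp [← ha, ← hx]; ring
  · simp [← hb, ← hy]; ring

/-- A totally positive non-unit has a totally positive prime factor. -/
lemma exists_prime {m : Zs} (hm : TP m) (hu : ¬ IsUnit m) :
    ∃ p n : Zs, Prime p ∧ TP p ∧ TP n ∧ m = p * n := by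
  obtain ⟨p, hp, n, hn⟩ := WfDvdMonoid.exists_irreducible_factor hu hm.ne
  have hp' : Prime p := hp.prime
  obtain ⟨u, ⟨u, rfl⟩, hu⟩ := exists_TP hp'.ne_zero
  have e : m = (p * u) * ((u⁻¹ : Zsˣ) * n) := by
    rw [hn]
    have : (u : Zs) * ((u⁻¹ : Zsˣ) : Zs) = 1 := by simp
    linear_combination (-(p * n)) * this
  refine ⟨p * u, (u⁻¹ : Zsˣ) * n, ?_, hu, ?_, e⟩
  · exact (Associated.prime_iff ⟨u, rfl⟩).1 hp'
  · rw [e, mul_comm] at hm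
    exact hm.of_mul hu

end FourSq

namespace FourSq

/-- The octahedral maximal order over `ℤ[√2]`: coordinates with respect to the basis
`1, (1+i)/√2, (1+j)/√2, (1+i+j+k)/2`. -/
@[ext] structure Oc where
  x0 : Zs
  x1 : Zs
  x2 : Zs
  x3 : Zs

namespace Oc

instance : Zero Oc := ⟨⟨0, 0, 0, 0⟩⟩
instance : One Oc := ⟨⟨1, 0, 0, 0⟩⟩
instance : Add Oc := ⟨fun x y => ⟨x.x0 + y.x0, x.x1 + y.x1, x.x2 + y.x2, x.x3 + y.x3⟩⟩
instance : Neg Oc := ⟨fun x => ⟨-x.x0, -x.x1, -x.x2, -x.x3⟩⟩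
instance : Sub Oc := ⟨fun x y => ⟨x.x0 - y.x0, x.x1 - y.x1, x.x2 - y.x2, x.x3 - y.x3⟩⟩
instance : Mul Oc := ⟨fun x y =>
  ⟨x.x0 * y.x0 - x.x1 * y.x1 - x.x2 * y.x1 - x.x2 * y.x2 - s * x.x2 * y.x3 - s * x.x3 * y.x1
      - x.x3 * y.x3,
   x.x0 * y.x1 + x.x1 * y.x0 + s * x.x1 * y.x1 + s * x.x2 * y.x1 + x.x2 * y.x3
      + (s * s - 1) * x.x3 * y.x1 - x.x3 * y.x2,
   x.x0 * y.x2 + x.x2 * y.x0 - x.x1 * y.x3 + s * x.x2 * y.x1 + s * x.x2 * y.x2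
      + (s * s - 1) * x.x2 * y.x3 + x.x3 * y.x1,
   x.x0 * y.x3 + x.x3 * y.x0 + x.x1 * y.x2 + s * x.x1 * y.x3 - x.x2 * y.x1 + s * x.x3 * y.x2
      + (s * s - 1) * x.x3 * y.x3⟩⟩

@[simp] lemma zero_x0 : (0 : Oc).x0 = 0 := rfl
@[simp] lemma zero_x1 : (0 : Oc).x1 = 0 := rfl
@[simp] lemma zero_x2 : (0 : Oc).x2 = 0 := rfl
@[simp] lemma zero_x3 : (0 : Oc).x3 = 0 := rfl
@[simp] lemma one_x0 : (1 : Oc).x0 = 1 := rfl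
@[simp] lemma one_x1 : (1 : Oc).x1 = 0 := rfl
@[simp] lemma one_x2 : (1 : Oc).x2 = 0 := rfl
@[simp] lemma one_x3 : (1 : Oc).x3 = 0 := rfl
@[simp] lemma add_x0 (x y : Oc) : (x + y).x0 = x.x0 + y.x0 := rfl
@[simp] lemma add_x1 (x y : Oc) : (x + y).x1 = x.x1 + y.x1 := rfl
@[simp] lemma add_x2 (x y : Oc) : (x + y).x2 = x.x2 + y.x2 := rfl
@[simp] lemma add_x3 (x y : Oc) : (x + y).x3 = x.x3 + y.x3 := rfl
@[simp] lemma sub_x0 (x y : Oc) : (x - y).x0 = x.x0 - y.x0 := rfl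
@[simp] lemma sub_x1 (x y : Oc) : (x - y).x1 = x.x1 - y.x1 := rfl
@[simp] lemma sub_x2 (x y : Oc) : (x - y).x2 = x.x2 - y.x2 := rfl
@[simp] lemma sub_x3 (x y : Oc) : (x - y).x3 = x.x3 - y.x3 := rfl
@[simp] lemma neg_x0 (x : Oc) : (-x).x0 = -x.x0 := rfl
@[simp] lemma neg_x1 (x : Oc) : (-x).x1 = -x.x1 := rfl
@[simp] lemma neg_x2 (x : Oc) : (-x).x2 = -x.x2 := rfl
@[simp] lemma neg_x3 (x : Oc) : (-x).x3 = -x.x3 := rfl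
@[simp] lemma mul_x0 (x y : Oc) : (x * y).x0 = x.x0 * y.x0 - x.x1 * y.x1 - x.x2 * y.x1
    - x.x2 * y.x2 - s * x.x2 * y.x3 - s * x.x3 * y.x1 - x.x3 * y.x3 := rfl
@[simp] lemma mul_x1 (x y : Oc) : (x * y).x1 = x.x0 * y.x1 + x.x1 * y.x0 + s * x.x1 * y.x1
    + s * x.x2 * y.x1 + x.x2 * y.x3 + (s * s - 1) * x.x3 * y.x1 - x.x3 * y.x2 := rfl
@[simp] lemma mul_x2 (x y : Oc) : (x * y).x2 = x.x0 * y.x2 + x.x2 * y.x0 - x.x1 * y.x3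
    + s * x.x2 * y.x1 + s * x.x2 * y.x2 + (s * s - 1) * x.x2 * y.x3 + x.x3 * y.x1 := rfl
@[simp] lemma mul_x3 (x y : Oc) : (x * y).x3 = x.x0 * y.x3 + x.x3 * y.x0 + x.x1 * y.x2
    + s * x.x1 * y.x3 - x.x2 * y.x1 + s * x.x3 * y.x2 + (s * s - 1) * x.x3 * y.x3 := rfl

instance : AddCommGroup Oc where
  add_assoc a b c := by ext1 <;> simp [add_assoc]
  zero_add a := by ext1 <;> simp
  add_zero a := by ext1 <;> simp
  add_comm a b := by ext1 <;> simp [add_comm]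
  neg_add_cancel a := by ext1 <;> simp
  sub_eq_add_neg a b := by ext1 <;> simp [sub_eq_add_neg]
  nsmul := nsmulRec
  zsmul := zsmulRec

instance : Ring Oc :=
  { (inferInstance : AddCommGroup Oc) with
    mul_assoc := by
      intro a b c
      ext1 <;> simp only [mul_x0, mul_x1, mul_x2, mul_x3] <;> ring
    one_mul := by intro a; ext1 <;> simp
    mul_one := by intro a; ext1 <;> simp
    left_distrib := by
      intro a b c
      ext1 <;> simp only [mul_x0, mul_x1, mul_x2, mul_x3, add_x0, add_x1, add_x2, add_x3] <;> ring
    right_distrib := by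
      intro a b c
      ext1 <;> simp only [mul_x0, mul_x1, mul_x2, mul_x3, add_x0, add_x1, add_x2, add_x3] <;> ring
    zero_mul := by intro a; ext1 <;> simp
    mul_zero := by intro a; ext1 <;> simp }

/-- The reduced norm. -/
def nrd (x : Oc) : Zs := x.x0 * x.x0 + x.x1 * x.x1 + x.x2 * x.x2 + x.x3 * x.x3
  + s * x.x0 * x.x1 + s * x.x0 * x.x2 + (s * s - 1) * x.x0 * x.x3 + x.x1 * x.x2
  + s * x.x1 * x.x3 + s * x.x2 * x.x3

lemma nrd_mul (x y : Oc) : nrd (x * y) = nrd x * nrd y := by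
  simp only [nrd, mul_x0, mul_x1, mul_x2, mul_x3]; ring

/-- Scalars. -/
def C (r : Zs) : Oc := ⟨r, 0, 0, 0⟩
@[simp] lemma C_x0 (r : Zs) : (C r).x0 = r := rfl
@[simp] lemma C_x1 (r : Zs) : (C r).x1 = 0 := rfl
@[simp] lemma C_x2 (r : Zs) : (C r).x2 = 0 := rfl
@[simp] lemma C_x3 (r : Zs) : (C r).x3 = 0 := rfl
lemma C_one : C 1 = 1 := rfl
lemma C_mul (r t : Zs) : C (r * t) = C r * C t := by ext1 <;> simp
lemma C_comm (r : Zs) (x : Oc) : C r * x = x * C r := by ext1 <;> simp [mul_comm]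
lemma nrd_C (r : Zs) : nrd (C r) = r * r := by simp [nrd]
lemma nrd_one : nrd 1 = 1 := by simp [nrd]
lemma nrd_zero : nrd 0 = 0 := by simp [nrd]
lemma nrd_neg (x : Oc) : nrd (-x) = nrd x := by simp [nrd]

/-- The conjugate. -/
def cj (x : Oc) : Oc :=
  ⟨x.x0 + s * x.x1 + s * x.x2 + (s * s - 1) * x.x3, -x.x1, -x.x2, -x.x3⟩
lemma mul_cj (x : Oc) : x * cj x = C (nrd x) := by
  ext1 <;> simp only [mul_x0, mul_x1, mul_x2, mul_x3, cj, C, nrd] <;> ring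
lemma cj_mul (x : Oc) : cj x * x = C (nrd x) := by
  ext1 <;> simp only [mul_x0, mul_x1, mul_x2, mul_x3, cj, C, nrd] <;> ring
lemma nrd_cj (x : Oc) : nrd (cj x) = nrd x := by
  simp only [cj, nrd]; ring

/-- Twice the quaternion coordinates. -/
def d0 (x : Oc) : Zs := 2 * x.x0 + s * x.x1 + s * x.x2 + x.x3
/-- Twice the quaternion coordinates. -/
def d1 (x : Oc) : Zs := s * x.x1 + x.x3
/-- Twice the quaternion coordinates. -/
def d2 (x : Oc) : Zs := s * x.x2 + x.x3
/-- Twice the quaternion coordinates. -/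
def d3 (x : Oc) : Zs := x.x3

lemma four_nrd (x : Oc) : 4 * nrd x = d0 x * d0 x + d1 x * d1 x + d2 x * d2 x + d3 x * d3 x := by
  simp only [nrd, d0, d1, d2, d3]
  linear_combination (2 * x.x1 ^ 2 + 2 * x.x2 ^ 2 + 2 * x.x1 * x.x2 - 4 * x.x0 * x.x3) * (-s_mul)

lemma eq_of_d {x y : Oc} (h0 : d0 x = d0 y) (h1 : d1 x = d1 y) (h2 : d2 x = d2 y)
    (h3 : d3 x = d3 y) : x = y := by
  simp only [d0, d1, d2, d3] at *
  have e1 : x.x1 = y.x1 := by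
    apply mul_left_cancel₀ s_ne; linear_combination h1 - h3
  have e2 : x.x2 = y.x2 := by
    apply mul_left_cancel₀ s_ne; linear_combination h2 - h3
  have e0 : x.x0 = y.x0 := by
    apply mul_left_cancel₀ two_ne; rw [e1, e2, h3] at h0; linear_combination h0
  ext1 <;> assumption

/-- The Euclidean (E8) form. -/
def E8 (x : Oc) : ℤ := ((d0 x).re + (d0 x).im) ^ 2 + (d0 x).im ^ 2
  + ((d1 x).re + (d1 x).im) ^ 2 + (d1 x).im ^ 2
  + ((d2 x).re + (d2 x).im) ^ 2 + (d2 x).im ^ 2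
  + ((d3 x).re + (d3 x).im) ^ 2 + (d3 x).im ^ 2

lemma four_nrd_re (x : Oc) : 4 * (nrd x).re = (d0 x).re ^ 2 + (d1 x).re ^ 2 + (d2 x).re ^ 2
    + (d3 x).re ^ 2 + 2 * ((d0 x).im ^ 2 + (d1 x).im ^ 2 + (d2 x).im ^ 2 + (d3 x).im ^ 2) := by
  have := congrArg Zsqrtd.re (four_nrd x)
  simp only [Zsqrtd.re_mul, Zsqrtd.re_add, Zsqrtd.re_ofNat, Zsqrtd.im_ofNat] at this
  push_cast at this
  linarith

lemma four_nrd_im (x : Oc) : 4 * (nrd x).im = 2 * ((d0 x).re * (d0 x).im + (d1 x).re * (d1 x).im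
    + (d2 x).re * (d2 x).im + (d3 x).re * (d3 x).im) := by
  have := congrArg Zsqrtd.im (four_nrd x)
  simp only [Zsqrtd.im_mul, Zsqrtd.im_add, Zsqrtd.re_ofNat, Zsqrtd.im_ofNat] at this
  push_cast at this
  linarith

lemma E8_eq (x : Oc) : E8 x = 4 * ((nrd x).re + (nrd x).im) := by
  rw [mul_add, four_nrd_re, four_nrd_im, E8]; ring

lemma norm_nrd_le (x : Oc) : 8 * (nrd x).norm ≤ (E8 x) ^ 2 := by
  rw [E8_eq, norm_def']
  nlinarith [sq_nonneg ((nrd x).re + 2 * (nrd x).im)]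

lemma nrd_finite (m : Zs) : {x : Oc | nrd x = m}.Finite := by
  let f : Oc → (ℤ × ℤ) × (ℤ × ℤ) × (ℤ × ℤ) × (ℤ × ℤ) := fun x =>
    (((d0 x).re + (d0 x).im, (d0 x).im), ((d1 x).re + (d1 x).im, (d1 x).im),
     ((d2 x).re + (d2 x).im, (d2 x).im), ((d3 x).re + (d3 x).im, (d3 x).im))
  have hf : Function.Injective f := by
    intro x y h
    simp only [f, Prod.mk.injEq] at h
    obtain ⟨⟨h0, h0'⟩, ⟨h1, h1'⟩, ⟨h2, h2'⟩, h3, h3'⟩ := h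
    apply eq_of_d <;> apply Zsqrtd.ext <;> omega
  set B := 4 * (m.re + m.im)
  let I := Set.Icc (-B) B
  have hI : I.Finite := Set.finite_Icc _ _
  have hII := hI.prod hI
  refine ((hII.prod (hII.prod (hII.prod hII))).preimage hf.injOn).subset ?_
  intro x hx
  have h := E8_eq x
  rw [show nrd x = m from hx, E8] at h
  have key : ∀ c : ℤ, c ^ 2 ≤ B → c ∈ I := by
    intro c hc
    constructor <;> nlinarith [Int.le_self_sq c, Int.le_self_sq (-c)]
  simp only [f, Set.mem_preimage, Set.mem_prod]
  refine ⟨⟨key _ ?_, key _ ?_⟩, ⟨key _ ?_, key _ ?_⟩, ⟨key _ ?_, key _ ?_⟩, key _ ?_, key _ ?_⟩ <;>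
  nlinarith [sq_nonneg ((d0 x).re + (d0 x).im), sq_nonneg (d0 x).im,
    sq_nonneg ((d1 x).re + (d1 x).im), sq_nonneg (d1 x).im,
    sq_nonneg ((d2 x).re + (d2 x).im), sq_nonneg (d2 x).im,
    sq_nonneg ((d3 x).re + (d3 x).im), sq_nonneg (d3 x).im]

lemma nrd_TP {x : Oc} (hx : x ≠ 0) : TP (nrd x) := by
  have h4 : TP (4 * nrd x) := by
    rw [four_nrd]
    have key : ∀ a b : Zs, (a = 0 ∨ TP a) → (TP (a + b * b) ∨ (a = 0 ∧ b = 0)) := by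
      intro a b h
      by_cases hb : b = 0
      · subst hb; simp only [mul_zero, add_zero, and_true]; exact h.symm
      · rcases h with h | h
        · subst h; left; rw [zero_add]; exact TP_sq hb
        · left; exact h.add (TP_sq hb)
    have k0 := key 0 (d0 x) (Or.inl rfl)
    rw [zero_add] at k0
    have k1 := key (d0 x * d0 x) (d1 x) (by
      rcases k0 with h | h
      · exact Or.inr h
      · left; simp [h.2])
    have k2 := key (d0 x * d0 x + d1 x * d1 x) (d2 x) (by
      rcases k1 with h | h
      · exact Or.inr h
      · left; simp [h])
    have k3 := key (d0 x * d0 x + d1 x * d1 x + d2 x * d2 x) (d3 x) (by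
      rcases k2 with h | h
      · exact Or.inr h
      · left; simp [h])
    rcases k3 with h | ⟨h, h3⟩
    · exact h
    · exfalso
      rcases k2 with k | ⟨h', h2⟩
      · exact k.ne h
      · rcases k1 with k | ⟨h'', h1⟩
        · exact k.ne h'
        · apply hx
          apply eq_of_d
          · rw [mul_self_eq_zero.1 h'']; simp [d0]
          · rw [h1]; simp [d1]
          · rw [h2]; simp [d2]
          · rw [h3]; simp [d3]
  rw [mul_comm] at h4
  refine h4.of_mul ?_
  constructor
  · simp
  · rw [norm_def']; simp

lemma nrd_eq_zero {x : Oc} : nrd x = 0 ↔ x = 0 := by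
  constructor
  · intro h; by_contra hx; exact (nrd_TP hx).ne h
  · rintro rfl; exact nrd_zero

instance : NoZeroDivisors Oc := ⟨by
  intro a b h
  have := congrArg nrd h
  rw [nrd_mul, nrd_zero, mul_eq_zero, nrd_eq_zero, nrd_eq_zero] at this
  exact this⟩

instance : Nontrivial Oc := ⟨0, 1, by
  intro h; have := congrArg x0 h; simp at this⟩

instance : IsDomain Oc := NoZeroDivisors.to_isDomain _

end Oc
end FourSq

namespace FourSq
namespace Oc

/-- Rounding one coordinate, together with the second-best choice (of the other parity). -/
lemma round2 (t M : ℤ) (hM : 0 < M) : ∃ k l : ℤ, (l + k) % 2 = 1 ∧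
    4 * (t - M * k) ^ 2 ≤ M ^ 2 ∧ (t - M * l) ^ 2 ≤ M ^ 2 ∧
    3 * (t - M * k) ^ 2 + (t - M * l) ^ 2 ≤ M ^ 2 := by
  obtain ⟨k, hk⟩ := round t M hM
  rcases le_total 0 (t - M * k) with h | h
  · rw [abs_of_nonneg h] at hk
    have e : t - M * (k + 1) = (t - M * k) - M := by ring
    refine ⟨k, k + 1, by omega, ?_, ?_, ?_⟩
    · nlinarith
    · rw [e]; nlinarith
    · rw [e]; nlinarith
  · rw [abs_of_nonpos h] at hk
    have e : t - M * (k - 1) = (t - M * k) + M := by ring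
    refine ⟨k, k - 1, by omega, ?_, ?_, ?_⟩
    · nlinarith
    · rw [e]; nlinarith
    · rw [e]; nlinarith

/-- Covering property of the `E8` lattice (weak form). -/
lemma covering (M : ℤ) (hM : 0 < M) (t0 t1 t2 t3 u0 u1 u2 u3 : ℤ) :
    ∃ c0 c1 c2 c3 b0 b1 b2 b3 : ℤ, (c0 + b0 + (c3 + b3)) % 2 = 0 ∧ (c1 + b1 + (c3 + b3)) % 2 = 0 ∧
      (c2 + b2 + (c3 + b3)) % 2 = 0 ∧ (b0 + b1 + b2 + b3) % 2 = 0 ∧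
      4 * ((t0 - M * c0) ^ 2 + (t1 - M * c1) ^ 2 + (t2 - M * c2) ^ 2 + (t3 - M * c3) ^ 2
       + (u0 - M * b0) ^ 2 + (u1 - M * b1) ^ 2 + (u2 - M * b2) ^ 2 + (u3 - M * b3) ^ 2)
       ≤ 11 * M ^ 2 := by
  obtain ⟨c0, c0', p0, f0, g0, h0⟩ := round2 t0 M hM
  obtain ⟨c1, c1', p1, f1, g1, h1⟩ := round2 t1 M hM
  obtain ⟨c2, c2', p2, f2, g2, h2⟩ := round2 t2 M hM
  obtain ⟨c3, c3', p3, f3, g3, h3⟩ := round2 t3 M hM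
  obtain ⟨b0, b0', q0, j0, k0, l0⟩ := round2 u0 M hM
  obtain ⟨b1, b1', q1, j1, k1, l1⟩ := round2 u1 M hM
  obtain ⟨b2, b2', q2, j2, k2, l2⟩ := round2 u2 M hM
  obtain ⟨b3, b3', q3, j3, k3, l3⟩ := round2 u3 M hM
  have four : ∀ (P : Prop) (a b c d : ℤ), a + b + c + d ≤ 32 * M ^ 2 → (a ≤ 11 * M ^ 2 → P) →
      (b ≤ 11 * M ^ 2 → P) → (c ≤ 11 * M ^ 2 → P) → (d ≤ 11 * M ^ 2 → P) → P := by
    intro P a b c d h ha hb hc hd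
    by_contra hP
    have ha' : ¬ a ≤ 11 * M ^ 2 := fun h => hP (ha h)
    have hb' : ¬ b ≤ 11 * M ^ 2 := fun h => hP (hb h)
    have hc' : ¬ c ≤ 11 * M ^ 2 := fun h => hP (hc h)
    have hd' : ¬ d ≤ 11 * M ^ 2 := fun h => hP (hd h)
    have : 0 < M ^ 2 := by positivity
    linarith
  have hM2 : 0 < M ^ 2 := by positivity
  by_cases a0 : (c0 + b0 + (c3 + b3)) % 2 = 0 <;> by_cases a1 : (c1 + b1 + (c3 + b3)) % 2 = 0 <;>
  by_cases a2 : (c2 + b2 + (c3 + b3)) % 2 = 0 <;> by_cases a3 : (b0 + b1 + b2 + b3) % 2 = 0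
  -- all equal
  · exact ⟨c0, c1, c2, c3, b0, b1, b2, b3, by omega, by omega, by omega, by omega, by linarith⟩
  · refine four _ _ _ _ _ ?_
      (fun h => ⟨c0', c1, c2, c3, b0', b1, b2, b3, by omega, by omega, by omega, by omega, h⟩)
      (fun h => ⟨c0, c1', c2, c3, b0, b1', b2, b3, by omega, by omega, by omega, by omega, h⟩)
      (fun h => ⟨c0, c1, c2', c3, b0, b1, b2', b3, by omega, by omega, by omega, by omega, h⟩)
      (fun h => ⟨c0, c1, c2, c3', b0, b1, b2, b3', by omega, by omega, by omega, by omega, h⟩)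
    linarith
  -- index 2 differs
  · exact ⟨c0, c1, c2', c3, b0, b1, b2, b3, by omega, by omega, by omega, by omega, by linarith⟩
  · exact ⟨c0, c1, c2, c3, b0, b1, b2', b3, by omega, by omega, by omega, by omega, by linarith⟩
  -- index 1 differs
  · exact ⟨c0, c1', c2, c3, b0, b1, b2, b3, by omega, by omega, by omega, by omega, by linarith⟩
  · exact ⟨c0, c1, c2, c3, b0, b1', b2, b3, by omega, by omega, by omega, by omega, by linarith⟩
  -- {1,2} against {0,3}
  · refine four _ _ _ _ _ ?_
      (fun h => ⟨c0, c1', c2', c3, b0, b1, b2, b3, by omega, by omega, by omega, by omega, h⟩)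
      (fun h => ⟨c0, c1, c2, c3, b0, b1', b2', b3, by omega, by omega, by omega, by omega, h⟩)
      (fun h => ⟨c0', c1, c2, c3', b0, b1, b2, b3, by omega, by omega, by omega, by omega, h⟩)
      (fun h => ⟨c0, c1, c2, c3, b0', b1, b2, b3', by omega, by omega, by omega, by omega, h⟩)
    linarith
  · refine four _ _ _ _ _ ?_
      (fun h => ⟨c0, c1', c2, c3, b0, b1, b2', b3, by omega, by omega, by omega, by omega, h⟩)
      (fun h => ⟨c0, c1, c2', c3, b0, b1', b2, b3, by omega, by omega, by omega, by omega, h⟩)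
      (fun h => ⟨c0', c1, c2, c3, b0, b1, b2, b3', by omega, by omega, by omega, by omega, h⟩)
      (fun h => ⟨c0, c1, c2, c3', b0', b1, b2, b3, by omega, by omega, by omega, by omega, h⟩)
    linarith
  -- index 0 differs
  · exact ⟨c0', c1, c2, c3, b0, b1, b2, b3, by omega, by omega, by omega, by omega, by linarith⟩
  · exact ⟨c0, c1, c2, c3, b0', b1, b2, b3, by omega, by omega, by omega, by omega, by linarith⟩
  -- {0,2} against {1,3}
  · refine four _ _ _ _ _ ?_
      (fun h => ⟨c0', c1, c2', c3, b0, b1, b2, b3, by omega, by omega, by omega, by omega, h⟩)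
      (fun h => ⟨c0, c1, c2, c3, b0', b1, b2', b3, by omega, by omega, by omega, by omega, h⟩)
      (fun h => ⟨c0, c1', c2, c3', b0, b1, b2, b3, by omega, by omega, by omega, by omega, h⟩)
      (fun h => ⟨c0, c1, c2, c3, b0, b1', b2, b3', by omega, by omega, by omega, by omega, h⟩)
    linarith
  · refine four _ _ _ _ _ ?_
      (fun h => ⟨c0', c1, c2, c3, b0, b1, b2', b3, by omega, by omega, by omega, by omega, h⟩)
      (fun h => ⟨c0, c1, c2', c3, b0', b1, b2, b3, by omega, by omega, by omega, by omega, h⟩)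
      (fun h => ⟨c0, c1', c2, c3, b0, b1, b2, b3', by omega, by omega, by omega, by omega, h⟩)
      (fun h => ⟨c0, c1, c2, c3', b0, b1', b2, b3, by omega, by omega, by omega, by omega, h⟩)
    linarith
  -- {0,1} against {2,3}
  · refine four _ _ _ _ _ ?_
      (fun h => ⟨c0', c1', c2, c3, b0, b1, b2, b3, by omega, by omega, by omega, by omega, h⟩)
      (fun h => ⟨c0, c1, c2, c3, b0', b1', b2, b3, by omega, by omega, by omega, by omega, h⟩)
      (fun h => ⟨c0, c1, c2', c3', b0, b1, b2, b3, by omega, by omega, by omega, by omega, h⟩)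
      (fun h => ⟨c0, c1, c2, c3, b0, b1, b2', b3', by omega, by omega, by omega, by omega, h⟩)
    linarith
  · refine four _ _ _ _ _ ?_
      (fun h => ⟨c0', c1, c2, c3, b0, b1', b2, b3, by omega, by omega, by omega, by omega, h⟩)
      (fun h => ⟨c0, c1', c2, c3, b0', b1, b2, b3, by omega, by omega, by omega, by omega, h⟩)
      (fun h => ⟨c0, c1, c2', c3, b0, b1, b2, b3', by omega, by omega, by omega, by omega, h⟩)
      (fun h => ⟨c0, c1, c2, c3', b0, b1, b2', b3, by omega, by omega, by omega, by omega, h⟩)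
    linarith
  -- index 3 differs
  · exact ⟨c0, c1, c2, c3', b0, b1, b2, b3, by omega, by omega, by omega, by omega, by linarith⟩
  · exact ⟨c0, c1, c2, c3, b0, b1, b2, b3', by omega, by omega, by omega, by omega, by linarith⟩

/-- An element of the order from its doubled coordinates. -/
lemma exists_of_d (a0 b0 a1 b1 a2 b2 a3 b3 : ℤ) (h0 : (a0 - a3) % 2 = 0) (h1 : (a1 - a3) % 2 = 0)
    (h2 : (a2 - a3) % 2 = 0) (hb : (b0 + b1 + b2 + b3) % 2 = 0) :
    ∃ x : Oc, d0 x = ⟨a0, b0⟩ ∧ d1 x = ⟨a1, b1⟩ ∧ d2 x = ⟨a2, b2⟩ ∧ d3 x = ⟨a3, b3⟩ := by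
  refine ⟨⟨⟨(a0 - a1 - a2 + a3) / 2, (b0 - b1 - b2 + b3) / 2⟩, ⟨b1 - b3, (a1 - a3) / 2⟩,
    ⟨b2 - b3, (a2 - a3) / 2⟩, ⟨a3, b3⟩⟩, ?_, ?_, ?_, ?_⟩ <;> ext <;>
  simp [d0, d1, d2, d3, s] <;> omega

lemma d0_sub (x y : Oc) (M : ℤ) : d0 (x - C M * y) = d0 x - M * d0 y := by
  simp [d0]; ring
lemma d1_sub (x y : Oc) (M : ℤ) : d1 (x - C M * y) = d1 x - M * d1 y := by
  simp [d1]; ring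
lemma d2_sub (x y : Oc) (M : ℤ) : d2 (x - C M * y) = d2 x - M * d2 y := by
  simp [d2]; ring
lemma d3_sub (x y : Oc) (M : ℤ) : d3 (x - C M * y) = d3 x - M * d3 y := by
  simp [d3]

lemma approx (M : ℤ) (hM : 0 < M) (z : Oc) : ∃ q : Oc, (nrd (z - C M * q)).norm < M ^ 4 := by
  obtain ⟨c0, c1, c2, c3, b0, b1, b2, b3, h0, h1, h2, h3, h⟩ := covering M hM
    ((d0 z).re + (d0 z).im) ((d1 z).re + (d1 z).im) ((d2 z).re + (d2 z).im) ((d3 z).re + (d3 z).im)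
    (d0 z).im (d1 z).im (d2 z).im (d3 z).im
  obtain ⟨q, e0, e1, e2, e3⟩ := exists_of_d (c0 - b0) b0 (c1 - b1) b1 (c2 - b2) b2 (c3 - b3) b3
    (by omega) (by omega) (by omega) (by omega)
  refine ⟨q, ?_⟩
  have hE : 4 * E8 (z - C M * q) ≤ 11 * M ^ 2 := by
    refine le_trans (le_of_eq ?_) h
    rw [E8, d0_sub, d1_sub, d2_sub, d3_sub, e0, e1, e2, e3]
    simp; ring
  have hE0 : 0 ≤ E8 (z - C M * q) := by unfold E8; positivity
  have := norm_nrd_le (z - C M * q)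
  have hM4 : 0 < M ^ 4 := by positivity
  have h16 : (4 * E8 (z - C M * q)) ^ 2 ≤ (11 * M ^ 2) ^ 2 := pow_le_pow_left₀ (by positivity) hE 2
  nlinarith

/-- Euclidean division. -/
lemma euclid (x y : Oc) (hy : y ≠ 0) : ∃ q : Oc, (nrd (x - q * y)).norm < (nrd y).norm := by
  have hn := (nrd_TP hy).2
  set M := (nrd y).norm with hM
  obtain ⟨q, hq⟩ := approx M hn (x * cj y * C (star (nrd y)))
  refine ⟨q, ?_⟩
  have e : (x - q * y) * (cj y * C (star (nrd y)))
      = x * cj y * C (star (nrd y)) - C M * q := by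
    rw [C_comm, hM, Zsqrtd.norm_eq_mul_conj, C_mul, ← mul_cj, sub_mul]; simp only [mul_assoc]
  rw [← e, nrd_mul, Zsqrtd.norm_mul] at hq
  have e2 : (nrd (cj y * C (star (nrd y)))).norm = M ^ 3 := by
    rw [nrd_mul, nrd_cj, nrd_C, Zsqrtd.norm_mul, Zsqrtd.norm_mul, Zsqrtd.norm_conj, ← hM]; ring
  rw [e2] at hq
  have : 0 < M ^ 3 := by positivity
  nlinarith

/-- Left ideals are principal. -/
lemma principal (I : Ideal Oc) {z : Oc} (hz : z ∈ I) (hz0 : z ≠ 0) :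
    ∃ y ∈ I, y ≠ 0 ∧ ∀ x ∈ I, ∃ w, x = w * y := by
  classical
  have hex : ∃ n : ℕ, ∃ y ∈ I, y ≠ 0 ∧ (nrd y).norm = n :=
    ⟨(nrd z).norm.toNat, z, hz, hz0, by have := (nrd_TP hz0).2; omega⟩
  obtain ⟨y, hy, hy0, hyn⟩ := Nat.find_spec hex
  refine ⟨y, hy, hy0, fun x hx => ?_⟩
  obtain ⟨q, hq⟩ := euclid x y hy0
  refine ⟨q, ?_⟩
  by_contra hne
  have h0 : x - q * y ≠ 0 := sub_ne_zero.2 hne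
  have hm : x - q * y ∈ I := I.sub_mem hx (I.mul_mem_left q hy)
  have hp := (nrd_TP h0).2
  refine Nat.find_min hex (m := (nrd (x - q * y)).norm.toNat) (by omega)
    ⟨_, hm, h0, by omega⟩

end Oc
end FourSq

namespace FourSq
namespace Oc

section act
variable {F : Type*} [Field F] (φ : Zs →+* F) (a b : F)

/-- First coordinate of the action on `F²`. -/
def act1 (x : Oc) (v w : F) : F :=
  (φ x.x0 + a * φ x.x2 - (b + 1 - φ s * a) * φ x.x3) * v
    + (-φ x.x1 + b * φ x.x2 + (a - φ s) * φ x.x3) * w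
/-- Second coordinate of the action on `F²`. -/
def act2 (x : Oc) (v w : F) : F :=
  (φ x.x1 + (b + 1 - φ s * a) * φ x.x2 + (a + φ s * (b + 1 - φ s * a)) * φ x.x3) * v
    + (φ x.x0 + φ s * φ x.x1 + (φ s - a) * φ x.x2 + (b + φ s * (φ s - a)) * φ x.x3) * w

lemma act1_mul (h : a * (φ s - a) - b * (b + 1 - φ s * a) = 1) 
    (x y : Oc) (v w : F) :
    act1 φ a b (x * y) v w = act1 φ a b x (act1 φ a b y v w) (act2 φ a b y v w) := by
  simp only [act1, act2, mul_x0, mul_x1, mul_x2, mul_x3, map_add, map_sub, map_mul, map_one]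
  grind

lemma act2_mul (h : a * (φ s - a) - b * (b + 1 - φ s * a) = 1) 
    (x y : Oc) (v w : F) :
    act2 φ a b (x * y) v w = act2 φ a b x (act1 φ a b y v w) (act2 φ a b y v w) := by
  simp only [act1, act2, mul_x0, mul_x1, mul_x2, mul_x3, map_add, map_sub, map_mul, map_one]
  grind

lemma act_ker (h : a * (φ s - a) - b * (b + 1 - φ s * a) = 1) 
    (x : Oc) (h1 : act1 φ a b x 1 0 = 0) (h2 : act1 φ a b x 0 1 = 0)
    (h3 : act2 φ a b x 1 0 = 0) (h4 : act2 φ a b x 0 1 = 0) :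
    φ x.x0 = 0 ∧ φ x.x1 = 0 ∧ φ x.x2 = 0 ∧ φ x.x3 = 0 := by
  have hs : φ s * φ s = 2 := by rw [← map_mul, s_mul]; exact map_ofNat φ 2
  simp only [act1, act2, mul_one, mul_zero, add_zero, zero_add] at h1 h2 h3 h4
  grind
end act
lemma exists_ab {F : Type*} [Field F] [Finite F] (t : F) (ht : t * t = 2) :
    ∃ a b : F, a * (t - a) - b * (b + 1 - t * a) = 1 := by
  by_cases h2 : (2 : F) = 0
  · rw [h2, mul_self_eq_zero] at ht
    refine ⟨1, 0, ?_⟩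
    rw [ht]
    linear_combination -h2
  · obtain ⟨p, hp⟩ := CharP.exists F
    have : NeZero p := ⟨CharP.char_ne_zero_of_finite F p⟩
    obtain ⟨a, b, hab⟩ := CharP.sq_add_sq F p (-1)
    have hab' : (a : F) ^ 2 + (b : F) ^ 2 = -1 := by exact_mod_cast hab
    refine ⟨t / 2 + b, (a + b) * t / 2, ?_⟩
    field_simp
    grind
end Oc
end FourSq

namespace FourSq
namespace Oc
open Classical in
/-- Elements of reduced norm `m`. -/
noncomputable def S (m : Zs) : Finset Oc := (nrd_finite m).toFinset

lemma mem_S {m : Zs} {x : Oc} : x ∈ S m ↔ nrd x = m := by simp [S]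

lemma nrd_add_C (u v : Oc) (p : Zs) : ∃ k, nrd (u + C p * v) = nrd u + p * k := by
  refine ⟨2 * (u.x0 * v.x0 + u.x1 * v.x1 + u.x2 * v.x2 + u.x3 * v.x3)
    + s * (u.x0 * v.x1 + u.x1 * v.x0) + s * (u.x0 * v.x2 + u.x2 * v.x0)
    + (s * s - 1) * (u.x0 * v.x3 + u.x3 * v.x0) + (u.x1 * v.x2 + u.x2 * v.x1)
    + s * (u.x1 * v.x3 + u.x3 * v.x1) + s * (u.x2 * v.x3 + u.x3 * v.x2) + p * nrd v, ?_⟩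
  simp only [nrd, add_x0, add_x1, add_x2, add_x3, mul_x0, mul_x1, mul_x2, mul_x3, C]
  ring

lemma isUnit_of_nrd {w : Oc} (h : IsUnit (nrd w)) : ∃ w', w' * w = 1 := by
  obtain ⟨r, hr⟩ := h.exists_right_inv
  refine ⟨C r * cj w, ?_⟩
  rw [mul_assoc, cj_mul, ← C_mul, mul_comm r, hr, C_one]

lemma unit_inv {u : Oc} (h : nrd u = 1) : cj u * u = 1 := by rw [cj_mul, h, C_one]
lemma unit_inv' {u : Oc} (h : nrd u = 1) : u * cj u = 1 := by rw [mul_cj, h, C_one]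

lemma gen {p : Zs} (hp : Prime p) (hpT : TP p) (I : Ideal Oc) (hI : C p ∈ I)
    (hx : ∃ x ∈ I, ¬ ∃ z, x = C p * z) (hn : ∀ z ∈ I, p ∣ nrd z) :
    ∃ y ∈ I, nrd y = p ∧ ∀ x ∈ I, ∃ w, x = w * y := by
  have hC : C p ≠ 0 := fun h => hp.ne_zero (by simpa using congrArg x0 h)
  obtain ⟨y, hy, hy0, hgen⟩ := principal I hI hC
  obtain ⟨w, hw⟩ := hgen _ hI
  obtain ⟨c, hc⟩ := hn y hy
  have e : p = nrd w * c := by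
    have := congrArg nrd hw
    rw [nrd_C, nrd_mul, hc] at this
    apply mul_left_cancel₀ hp.ne_zero
    linear_combination this
  have hcu : IsUnit c := by
    rcases hp.irreducible.isUnit_or_isUnit e with h | h
    · exfalso
      obtain ⟨w', hw'⟩ := isUnit_of_nrd h
      obtain ⟨x, hxI, hxn⟩ := hx
      obtain ⟨a, ha⟩ := hgen x hxI
      apply hxn
      refine ⟨a * w', ?_⟩
      rw [C_comm, hw, mul_assoc, ← mul_assoc w', hw', one_mul, ha]
    · exact h
  have hcT : TP c := by
    have := nrd_TP hy0
    rw [hc, mul_comm] at this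
    exact this.of_mul hpT
  obtain ⟨d, hd, hcd⟩ := unit_sq hcT hcu
  obtain ⟨d', hd'⟩ := hd.exists_right_inv
  refine ⟨C d' * y, I.mul_mem_left _ hy, ?_, ?_⟩
  · rw [nrd_mul, nrd_C, hc, hcd]
    linear_combination (p * (d * d' + 1)) * hd'
  · intro x hx
    obtain ⟨a, ha⟩ := hgen x hx
    refine ⟨a * C d, ?_⟩
    rw [mul_assoc, ← mul_assoc (C d), ← C_mul, hd', C_one, one_mul, ha]

open Classical in
lemma card_gen {p : Zs} (hp : Prime p) (hpT : TP p) (I : Ideal Oc) (hI : C p ∈ I)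
    (hx : ∃ x ∈ I, ¬ ∃ z, x = C p * z) (hn : ∀ z ∈ I, p ∣ nrd z) :
    ((S p).filter (fun y => y ∈ I)).card = (S 1).card := by
  obtain ⟨y, hy, hyn, hgen⟩ := gen hp hpT I hI hx hn
  have hy0 : y ≠ 0 := by rintro rfl; exact hp.ne_zero (by rw [← hyn, nrd_zero])
  have : (S p).filter (fun y => y ∈ I) = (S 1).image (fun u => u * y) := by
    ext z
    simp only [Finset.mem_filter, Finset.mem_image, mem_S]
    constructor
    · rintro ⟨h1, h2⟩
      obtain ⟨w, rfl⟩ := hgen z h2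
      refine ⟨w, ?_, rfl⟩
      rw [nrd_mul, hyn] at h1
      apply mul_right_cancel₀ hp.ne_zero
      rw [h1, one_mul]
    · rintro ⟨u, hu, rfl⟩
      exact ⟨by rw [nrd_mul, hu, hyn, one_mul], I.mul_mem_left _ hy⟩
  rw [this, Finset.card_image_of_injective]
  intro u v huv
  exact mul_right_cancel₀ hy0 huv

open Classical in
lemma card_div {p : Zs} (hp : Prime p) (hpT : TP p) {x : Oc} (hx : ¬ ∃ z, x = C p * z)
    (hn : p ∣ nrd x) :
    ((S p).filter (fun y => ∃ w, x = w * y)).card = (S 1).card := by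
  let I : Ideal Oc := Ideal.span {x, C p}
  have hmem : ∀ z, z ∈ I ↔ ∃ a b, a * x + b * C p = z := fun z => Ideal.mem_span_pair
  have hxI : x ∈ I := Ideal.subset_span (by simp)
  have hpI : C p ∈ I := Ideal.subset_span (by simp)
  have hnI : ∀ z ∈ I, p ∣ nrd z := by
    intro z hz
    obtain ⟨a, b, rfl⟩ := (hmem z).1 hz
    rw [← C_comm]
    obtain ⟨k, hk⟩ := nrd_add_C (a * x) b p
    rw [hk, nrd_mul]
    exact dvd_add (Dvd.dvd.mul_left hn _) (dvd_mul_right _ _)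
  rw [← card_gen hp hpT I hpI ⟨x, hxI, hx⟩ hnI]
  obtain ⟨y, hy, hyn, hgen⟩ := gen hp hpT I hpI ⟨x, hxI, hx⟩ hnI
  congr 1
  apply Finset.filter_congr
  intro z hz
  rw [mem_S] at hz
  constructor
  · rintro ⟨w, hw⟩
    obtain ⟨a, b, hab⟩ := (hmem y).1 hy
    have e : y = (a * w + b * cj z) * z := by
      rw [add_mul, mul_assoc, mul_assoc, ← hw, cj_mul, hz, hab]
    have e1 : nrd (a * w + b * cj z) = 1 := by
      have := congrArg nrd e
      rw [nrd_mul, hyn, hz] at this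
      apply mul_right_cancel₀ hp.ne_zero
      rw [← this, one_mul]
    have e2 : z = cj (a * w + b * cj z) * y := by
      rw [e, ← mul_assoc, unit_inv e1, one_mul]
    rw [e2]
    exact I.mul_mem_left _ hy
  · intro h
    obtain ⟨w, hw⟩ := hgen z h
    obtain ⟨a, ha⟩ := hgen x hxI
    have e1 : nrd w = 1 := by
      have := congrArg nrd hw
      rw [nrd_mul, hyn, hz] at this
      apply mul_right_cancel₀ hp.ne_zero
      rw [← this, one_mul]
    refine ⟨a * cj w, ?_⟩
    rw [hw, mul_assoc, ← mul_assoc (cj w), unit_inv e1, one_mul, ha]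

open Classical in
/-- The elements of norm `m` divisible by the scalar `p`. -/
noncomputable def Dv (p m : Zs) : Finset Oc := (S m).filter (fun x => ∃ z, x = C p * z)

open Classical in
lemma hecke {p m : Zs} (hp : Prime p) (hpT : TP p) :
    (S p).card * (S m).card + (S 1).card * (Dv p (p * m)).card
      = (S 1).card * (S (p * m)).card + (S p).card * (Dv p (p * m)).card := by
  have hmaps : ∀ a ∈ (S p) ×ˢ (S m), a.2 * a.1 ∈ S (p * m) := by
    rintro ⟨y, z⟩ h
    rw [Finset.mem_product, mem_S, mem_S] at h
    rw [mem_S, nrd_mul, h.1, h.2, mul_comm]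
  have h1 := Finset.card_eq_sum_card_fiberwise hmaps
  rw [Finset.card_product] at h1
  have hfib : ∀ x ∈ S (p * m), (((S p) ×ˢ (S m)).filter (fun a => a.2 * a.1 = x)).card
      = ((S p).filter (fun y => ∃ w, x = w * y)).card := by
    intro x hx
    rw [mem_S] at hx
    refine Finset.card_bij (fun a _ => a.1) ?_ ?_ ?_
    · rintro ⟨y, z⟩ h
      simp only [Finset.mem_filter, Finset.mem_product] at h ⊢
      exact ⟨h.1.1, z, h.2.symm⟩
    · rintro ⟨y, z⟩ h ⟨y', z'⟩ h' hyy
      simp only [Finset.mem_filter, Finset.mem_product, mem_S] at h h' hyy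
      subst hyy
      have hy0 : y ≠ 0 := by rintro rfl; exact hp.ne_zero (by rw [← h.1.1, nrd_zero])
      rw [mul_right_cancel₀ hy0 (h.2.trans h'.2.symm)]
    · intro y hy
      simp only [Finset.mem_filter, mem_S] at hy
      obtain ⟨hy, w, hw⟩ := hy
      refine ⟨(y, w), ?_, rfl⟩
      simp only [Finset.mem_filter, Finset.mem_product, mem_S]
      refine ⟨⟨hy, ?_⟩, hw.symm⟩
      rw [hw, nrd_mul, hy] at hx
      apply mul_left_cancel₀ hp.ne_zero
      rw [← hx, mul_comm]
  rw [Finset.sum_congr rfl hfib] at h1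
  rw [← Finset.sum_filter_add_sum_filter_not _ (fun x => ∃ z, x = C p * z)] at h1
  rw [Finset.sum_const_nat (m := (S p).card), Finset.sum_const_nat (m := (S 1).card)] at h1
  · have h2 := Finset.card_filter_add_card_filter_not (s := S (p * m)) (fun x => ∃ z, x = C p * z)
    rw [h1, ← h2, Dv]
    ring
  · intro x hx
    simp only [Finset.mem_filter, mem_S] at hx
    exact card_div hp hpT hx.2 (by rw [hx.1]; exact dvd_mul_right _ _)
  · intro x hx
    simp only [Finset.mem_filter, mem_S] at hx
    congr 1
    apply Finset.filter_true_of_mem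
    intro y hy
    rw [mem_S] at hy
    obtain ⟨_, z, hz⟩ := hx
    exact ⟨z * cj y, by rw [mul_assoc, cj_mul, hy, hz, C_comm]⟩

lemma C_ne {p : Zs} (hp : p ≠ 0) : C p ≠ 0 := fun h => hp (by simpa using congrArg x0 h)

open Classical in
lemma Dv_card {p m : Zs} (hp : p ≠ 0) : (Dv p (p * p * m)).card = (S m).card := by
  symm
  refine Finset.card_bij (fun x _ => C p * x) ?_ ?_ ?_
  · intro x hx
    rw [mem_S] at hx
    simp only [Dv, Finset.mem_filter, mem_S]
    exact ⟨by rw [nrd_mul, nrd_C, hx], x, rfl⟩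
  · intro x _ y _ h
    exact mul_left_cancel₀ (C_ne hp) h
  · intro x hx
    simp only [Dv, Finset.mem_filter, mem_S] at hx
    obtain ⟨h, z, rfl⟩ := hx
    refine ⟨z, ?_, rfl⟩
    rw [mem_S]
    rw [nrd_mul, nrd_C] at h
    exact mul_left_cancel₀ (mul_ne_zero hp hp) h

open Classical in
lemma Dv_zero {p m : Zs} (hp : p ≠ 0) (h : ¬ p ∣ m) : (Dv p (p * m)).card = 0 := by
  rw [Finset.card_eq_zero, Finset.eq_empty_iff_forall_notMem]
  intro x hx
  simp only [Dv, Finset.mem_filter, mem_S] at hx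
  obtain ⟨h', z, rfl⟩ := hx
  rw [nrd_mul, nrd_C] at h'
  apply h
  refine ⟨nrd z, ?_⟩
  apply mul_left_cancel₀ hp
  linear_combination -h'

lemma S_unit {m : Zs} (hm : TP m) (hu : IsUnit m) : (S m).card = (S 1).card := by
  obtain ⟨d, hd, rfl⟩ := unit_sq hm hu
  obtain ⟨d', hd'⟩ := hd.exists_right_inv
  symm
  refine Finset.card_bij (fun x _ => C d * x) ?_ ?_ ?_
  · intro x hx
    rw [mem_S] at hx ⊢
    rw [nrd_mul, nrd_C, hx, mul_one]
  · intro x _ y _ h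
    exact mul_left_cancel₀ (C_ne hd.ne_zero) h
  · intro x hx
    rw [mem_S] at hx
    refine ⟨C d' * x, ?_, ?_⟩
    · rw [mem_S, nrd_mul, nrd_C, hx]
      linear_combination (d * d' + 1) * hd'
    · rw [← mul_assoc, ← C_mul, hd', C_one, one_mul]

lemma act1_C {F : Type*} [Field F] (φ : Zs →+* F) (a b : F) (r : Zs) (v w : F) :
    act1 φ a b (C r) v w = φ r * v := by simp [act1]
lemma act2_C {F : Type*} [Field F] (φ : Zs →+* F) (a b : F) (r : Zs) (v w : F) :
    act2 φ a b (C r) v w = φ r * w := by simp [act2]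

lemma act_det {F : Type*} [Field F] (φ : Zs →+* F) (a b : F)
    (h : a * (φ s - a) - b * (b + 1 - φ s * a) = 1) (y : Oc) :
    act1 φ a b y 1 0 * act2 φ a b y 0 1 - act1 φ a b y 0 1 * act2 φ a b y 1 0 = φ (nrd y) := by
  simp only [act1, act2, nrd, map_add, map_mul, map_sub, map_one]
  grind

lemma line_card {F : Type*} [Field F] [Fintype F] [DecidableEq F] {A B : F}
    (h : ¬ (A = 0 ∧ B = 0)) :
    (Finset.univ.filter (fun v : F × F => A * v.1 + B * v.2 = 0)).card = Fintype.card F := by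
  symm
  refine Finset.card_bij (fun t _ => (B * t, -A * t)) ?_ ?_ ?_
  · intro t _
    simp only [Finset.mem_filter, Finset.mem_univ, true_and]; ring
  · intro x _ y _ hxy
    simp only [Prod.mk.injEq] at hxy
    by_cases hB : B = 0
    · have hA : -A ≠ 0 := by simpa using fun hA => h ⟨hA, hB⟩
      exact mul_left_cancel₀ hA hxy.2
    · exact mul_left_cancel₀ hB hxy.1
  · rintro ⟨v, w⟩ hv
    simp only [Finset.mem_filter, Finset.mem_univ, true_and] at hv
    by_cases hB : B = 0
    · have hA : A ≠ 0 := fun hA => h ⟨hA, hB⟩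
      refine ⟨-w / A, Finset.mem_univ _, ?_⟩
      subst hB
      have : v = 0 := by simpa [hA] using hv
      simp only [Prod.mk.injEq]
      constructor
      · rw [this]; ring
      · field_simp
    · refine ⟨v / B, Finset.mem_univ _, ?_⟩
      simp only [Prod.mk.injEq]
      constructor
      · field_simp
      · field_simp; linear_combination -hv

lemma ker_card {F : Type*} [Field F] [Fintype F] [DecidableEq F] {A B A' B' : F}
    (h : ¬ (A = 0 ∧ B = 0 ∧ A' = 0 ∧ B' = 0)) (hd : A * B' = B * A') :
    (Finset.univ.filter (fun v : F × F => A * v.1 + B * v.2 = 0 ∧ A' * v.1 + B' * v.2 = 0)).card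
      = Fintype.card F := by
  by_cases h1 : A = 0 ∧ B = 0
  · obtain ⟨rfl, rfl⟩ := h1
    rw [← line_card (A := A') (B := B') (by tauto)]
    congr 1; ext v; simp
  · rw [← line_card h1]
    congr 1
    ext v
    simp only [Finset.mem_filter, Finset.mem_univ, true_and, and_iff_left_iff_imp]
    intro hv
    by_cases hB : B = 0
    · subst hB
      have hA : A ≠ 0 := fun hA => h1 ⟨hA, rfl⟩
      apply mul_left_cancel₀ hA
      linear_combination A' * hv + v.2 * hd
    · apply mul_left_cancel₀ hB
      linear_combination B' * hv - v.1 * hd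

set_option maxHeartbeats 1000000 in
open Classical in
/-- Number of elements of prime norm. -/
lemma card_prime {p : Zs} (hp : Prime p) (hpT : TP p) {F : Type*} [Field F] [Finite F]
    (φ : Zs →+* F) (hsurj : Function.Surjective φ) (hker : ∀ x, φ x = 0 ↔ p ∣ x) :
    (S p).card = (S 1).card * (Nat.card F + 1) := by
  have := Fintype.ofFinite F
  have hs : φ s * φ s = 2 := by rw [← map_mul, s_mul]; exact map_ofNat φ 2
  obtain ⟨a, b, h⟩ := exists_ab (φ s) hs
  have hq : 1 < Fintype.card F := Fintype.one_lt_card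
  have hφp : φ p = 0 := (hker p).2 dvd_rfl
  -- the left ideal attached to a vector
  let I : F → F → Ideal Oc := fun v w =>
    { carrier := {x | act1 φ a b x v w = 0 ∧ act2 φ a b x v w = 0}
      add_mem' := by
        rintro x y ⟨h1, h2⟩ ⟨h3, h4⟩
        constructor
        · have : act1 φ a b (x + y) v w = act1 φ a b x v w + act1 φ a b y v w := by
            simp only [act1, add_x0, add_x1, add_x2, add_x3, map_add]; ring
          rw [this, h1, h3, add_zero]
        · have : act2 φ a b (x + y) v w = act2 φ a b x v w + act2 φ a b y v w := by
            simp only [act2, add_x0, add_x1, add_x2, add_x3, map_add]; ring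
          rw [this, h2, h4, add_zero]
      zero_mem' := by constructor <;> simp [act1, act2]
      smul_mem' := by
        rintro c x ⟨h1, h2⟩
        constructor
        · rw [smul_eq_mul, act1_mul φ a b h, h1, h2]; simp [act1]
        · rw [smul_eq_mul, act2_mul φ a b h, h1, h2]; simp [act2] }
  have memI : ∀ v w x, x ∈ I v w ↔ act1 φ a b x v w = 0 ∧ act2 φ a b x v w = 0 :=
    fun v w x => Iff.rfl
  clear_value I
  have hcol : ∀ v : F × F, v ≠ 0 → ((S p).filter (fun y => y ∈ I v.1 v.2)).card = (S 1).card := by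
    rintro ⟨v, w⟩ hv
    apply card_gen hp hpT
    · rw [memI, act1_C, act2_C, hφp]; simp
    · -- pigeonhole
      let f : F × F × F × F → F × F := fun x =>
        ((x.1 + a * x.2.2.1 - (b + 1 - φ s * a) * x.2.2.2) * v
          + (-x.2.1 + b * x.2.2.1 + (a - φ s) * x.2.2.2) * w,
         (x.2.1 + (b + 1 - φ s * a) * x.2.2.1 + (a + φ s * (b + 1 - φ s * a)) * x.2.2.2) * v
          + (x.1 + φ s * x.2.1 + (φ s - a) * x.2.2.1 + (b + φ s * (φ s - a)) * x.2.2.2) * w)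
      obtain ⟨x, y, hxy, hfe⟩ := Fintype.exists_ne_map_eq_of_card_lt f (by
        simp only [Fintype.card_prod]
        have : 1 < Fintype.card F * Fintype.card F := by nlinarith
        nlinarith)
      obtain ⟨z0, h0⟩ := hsurj (x.1 - y.1)
      obtain ⟨z1, h1⟩ := hsurj (x.2.1 - y.2.1)
      obtain ⟨z2, h2⟩ := hsurj (x.2.2.1 - y.2.2.1)
      obtain ⟨z3, h3⟩ := hsurj (x.2.2.2 - y.2.2.2)
      simp only [f, Prod.mk.injEq] at hfe
      refine ⟨⟨z0, z1, z2, z3⟩, ?_, ?_⟩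
      · rw [memI]
        simp only [act1, act2, h0, h1, h2, h3]
        constructor
        · linear_combination hfe.1
        · linear_combination hfe.2
      · rintro ⟨z, hz⟩
        apply hxy
        have g0 : φ z0 = 0 := (hker _).2 ⟨z.x0, by simpa using congrArg x0 hz⟩
        have g1 : φ z1 = 0 := (hker _).2 ⟨z.x1, by simpa using congrArg x1 hz⟩
        have g2 : φ z2 = 0 := (hker _).2 ⟨z.x2, by simpa using congrArg x2 hz⟩
        have g3 : φ z3 = 0 := (hker _).2 ⟨z.x3, by simpa using congrArg x3 hz⟩
        rw [g0] at h0; rw [g1] at h1; rw [g2] at h2; rw [g3] at h3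
        ext
        · exact (sub_eq_zero.1 h0.symm)
        · exact (sub_eq_zero.1 h1.symm)
        · exact (sub_eq_zero.1 h2.symm)
        · exact (sub_eq_zero.1 h3.symm)
    · intro z hz
      have hz' := (I v w).mul_mem_left (cj z) hz
      rw [cj_mul, memI, act1_C, act2_C] at hz'
      rw [← hker]
      by_contra hne
      apply hv
      simp only [mul_eq_zero, hne, false_or] at hz'
      ext
      · exact hz'.1
      · exact hz'.2
  have hrow : ∀ y ∈ S p, ((Finset.univ.filter (fun v : F × F => v ≠ 0)).filter
      (fun v => y ∈ I v.1 v.2)).card = Fintype.card F - 1 := by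
    intro y hy
    rw [mem_S] at hy
    have key : (Finset.univ.filter (fun v : F × F => y ∈ I v.1 v.2)).card = Fintype.card F := by
      have e1 : ∀ v w, act1 φ a b y v w = act1 φ a b y 1 0 * v + act1 φ a b y 0 1 * w := by
        intro v w; simp only [act1]; ring
      have e2 : ∀ v w, act2 φ a b y v w = act2 φ a b y 1 0 * v + act2 φ a b y 0 1 * w := by
        intro v w; simp only [act2]; ring
      rw [← ker_card (A := act1 φ a b y 1 0) (B := act1 φ a b y 0 1) (A' := act2 φ a b y 1 0)
        (B' := act2 φ a b y 0 1)]
      · congr 1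
        ext v
        rw [Finset.mem_filter, Finset.mem_filter, memI, e1, e2]
      · rintro ⟨h1, h2, h3, h4⟩
        obtain ⟨g0, g1, g2, g3⟩ := act_ker φ a b h y h1 h2 h3 h4
        rw [hker] at g0 g1 g2 g3
        obtain ⟨z0, g0⟩ := g0
        obtain ⟨z1, g1⟩ := g1
        obtain ⟨z2, g2⟩ := g2
        obtain ⟨z3, g3⟩ := g3
        have ey : y = C p * ⟨z0, z1, z2, z3⟩ := by ext1 <;> simp [g0, g1, g2, g3]
        rw [ey, nrd_mul, nrd_C] at hy
        apply hp.not_isUnit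
        refine IsUnit.of_mul_eq_one (nrd ⟨z0, z1, z2, z3⟩) ?_
        apply mul_left_cancel₀ hp.ne_zero
        linear_combination hy
      · have : φ (nrd y) = 0 := by rw [hy, hφp]
        have e : act1 φ a b y 1 0 * act2 φ a b y 0 1 - act1 φ a b y 0 1 * act2 φ a b y 1 0
            = φ (nrd y) := act_det φ a b h y
        linear_combination e + this
    rw [← key, Finset.filter_filter]
    have : (Finset.univ.filter (fun v : F × F => v ≠ 0 ∧ y ∈ I v.1 v.2))
        = (Finset.univ.filter (fun v : F × F => y ∈ I v.1 v.2)).erase 0 := by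
      ext v; simp
    rw [this, Finset.card_erase_of_mem]
    simp [memI, act1, act2]
  have main := Finset.card_mul_eq_card_mul (s := S p)
    (t := Finset.univ.filter (fun v : F × F => v ≠ 0)) (fun (y : Oc) (v : F × F) => y ∈ I v.1 v.2)
    (m := Fintype.card F - 1) (n := (S 1).card)
    (by
      intro y hy
      rw [← hrow y hy, Finset.bipartiteAbove]) (by
      intro v hv
      rw [← hcol v (by simpa using hv), Finset.bipartiteBelow])
  have ht : (Finset.univ.filter (fun v : F × F => v ≠ 0)).card
      = Fintype.card F * Fintype.card F - 1 := by
    have : (Finset.univ.filter (fun v : F × F => v ≠ 0)) = Finset.univ.erase 0 := by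
      ext v; simp
    rw [this, Finset.card_erase_of_mem (Finset.mem_univ _), Finset.card_univ, Fintype.card_prod]
  rw [ht] at main
  rw [Nat.card_eq_fintype_card]
  obtain ⟨n, hn⟩ : ∃ n, Fintype.card F = n + 2 := ⟨Fintype.card F - 2, by omega⟩
  rw [hn] at main ⊢
  have e1 : n + 2 - 1 = n + 1 := by omega
  have e2 : (n + 2) * (n + 2) - 1 = (n + 1) * (n + 3) := by
    rw [Nat.sub_eq_iff_eq_add (by nlinarith)]; ring
  rw [e1, e2] at main
  apply Nat.eq_of_mul_eq_mul_right (show 0 < n + 1 by omega)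
  rw [main]; ring

end Oc
end FourSq

namespace FourSq

lemma s_dvd (z : Zs) : s ∣ z ↔ (z.re : ZMod 2) = 0 := by
  rw [ZMod.intCast_zmod_eq_zero_iff_dvd _ 2]
  constructor
  · rintro ⟨w, rfl⟩
    exact ⟨w.im, by simp [s]⟩
  · rintro ⟨k, hk⟩
    refine ⟨⟨z.im, k⟩, ?_⟩
    ext <;> simp [s]
    simpa using hk

lemma two_dvd (z : Zs) : 2 ∣ z ↔ (z.re : ZMod 2) = 0 ∧ (z.im : ZMod 2) = 0 := by
  rw [ZMod.intCast_zmod_eq_zero_iff_dvd _ 2, ZMod.intCast_zmod_eq_zero_iff_dvd _ 2]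
  constructor
  · rintro ⟨w, rfl⟩
    exact ⟨⟨w.re, by simp⟩, ⟨w.im, by simp⟩⟩
  · rintro ⟨⟨k, hk⟩, l, hl⟩
    refine ⟨⟨k, l⟩, ?_⟩
    ext <;> simp
    · simpa using hk
    · simpa using hl

namespace Oc

/-- Representatives of the units modulo the quaternion group. -/
def T : Fin 6 → Oc := ![⟨1, 0, 0, 0⟩, ⟨-1, 0, 0, 1⟩, ⟨0, 0, 0, 1⟩, ⟨0, 1, 0, 0⟩, ⟨0, -1, -1, s⟩,
  ⟨0, 0, -1, s⟩]

lemma nrd_T (k : Fin 6) : nrd (T k) = 1 := by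
  fin_cases k <;> simp [T, nrd, s_mul] <;> norm_num

/-- Membership in the Lipschitz order. -/
def Lam (x : Oc) : Prop := 2 ∣ x.x3 ∧ s ∣ x.x1 ∧ s ∣ x.x2
/-- Elements of even trace. -/
def Dd (x : Oc) : Prop := s ∣ x.x3

open Classical in
lemma count_shift {t : Oc} (ht : nrd t = 1) (m : Zs) (P : Oc → Prop) :
    ((S m).filter (fun x => P (x * t))).card = ((S m).filter P).card := by
  refine Finset.card_bij (fun x _ => x * t) ?_ ?_ ?_
  · intro x hx
    simp only [Finset.mem_filter, mem_S] at hx ⊢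
    exact ⟨by rw [nrd_mul, ht, hx.1, mul_one], hx.2⟩
  · intro x _ y _ h
    have ht0 : t ≠ 0 := by rintro rfl; rw [nrd_zero] at ht; exact zero_ne_one ht
    exact mul_right_cancel₀ ht0 h
  · intro x hx
    simp only [Finset.mem_filter, mem_S] at hx
    refine ⟨x * cj t, ?_, by rw [mul_assoc, unit_inv ht, mul_one]⟩
    simp only [Finset.mem_filter, mem_S]
    exact ⟨by rw [nrd_mul, nrd_cj, ht, hx.1, mul_one],
      by rw [mul_assoc, unit_inv ht, mul_one]; exact hx.2⟩

open Classical in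
lemma count_six (m : Zs) (P : Oc → Prop) :
    ∑ x ∈ S m, (Finset.univ.filter (fun k : Fin 6 => P (x * T k))).card
      = 6 * ((S m).filter P).card := by
  have h := Finset.sum_card_bipartiteAbove_eq_sum_card_bipartiteBelow (s := S m)
    (t := (Finset.univ : Finset (Fin 6))) (fun x k => P (x * T k))
  rw [show 6 * ((S m).filter P).card = ∑ _k : Fin 6, ((S m).filter P).card by simp]
  simp only [Finset.bipartiteAbove, Finset.bipartiteBelow] at h
  rw [h]
  exact Finset.sum_congr rfl fun k _ => count_shift (nrd_T k) m P

open Classical in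
lemma count_three (m : Zs) (P : Oc → Prop) :
    ∑ x ∈ S m, (Finset.univ.filter (fun k : Fin 3 => P (x * T (k.castLE (by norm_num))))).card
      = 3 * ((S m).filter P).card := by
  have h := Finset.sum_card_bipartiteAbove_eq_sum_card_bipartiteBelow (s := S m)
    (t := (Finset.univ : Finset (Fin 3))) (fun x k => P (x * T (k.castLE (by norm_num))))
  rw [show 3 * ((S m).filter P).card = ∑ _k : Fin 3, ((S m).filter P).card by simp]
  simp only [Finset.bipartiteAbove, Finset.bipartiteBelow] at h
  rw [h]
  exact Finset.sum_congr rfl fun k _ => count_shift (nrd_T _) m P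


lemma z2 (z : ZMod 2) : z = 0 ∨ z = 1 := by revert z; decide


lemma z2_two : (2 : ZMod 2) = 0 := rfl

lemma z2_oo : (1 : ZMod 2) + 1 = 0 := rfl

lemma z2_neg (z : ZMod 2) : -z = z := by revert z; decide

lemma z2_self (z : ZMod 2) : z + z = 0 := by revert z; decide

open Classical in
lemma claimA (x : Oc) (hre : ((nrd x).re : ZMod 2) = 1) (him : ((nrd x).im : ZMod 2) = 0) :
    (Finset.univ.filter (fun k : Fin 6 => Lam (x * T k))).card = 1 := by
  obtain ⟨⟨a0, b0⟩, ⟨a1, b1⟩, ⟨a2, b2⟩, ⟨a3, b3⟩⟩ := x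
  rw [Finset.card_filter, Fin.sum_univ_six]
  simp only [Lam, two_dvd, s_dvd, T, Matrix.cons_val, mul_x1, mul_x2, mul_x3]
  simp [nrd, s, z2_two, sub_eq_add_neg, z2_neg] at hre him ⊢
  generalize (a0 : ZMod 2) = a0 at *
  generalize (a1 : ZMod 2) = a1 at *
  generalize (a2 : ZMod 2) = a2 at *
  generalize (a3 : ZMod 2) = a3 at *
  generalize (b0 : ZMod 2) = b0 at *
  generalize (b1 : ZMod 2) = b1 at *
  generalize (b2 : ZMod 2) = b2 at *
  generalize (b3 : ZMod 2) = b3 at *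
  rcases z2 a0 with rfl | rfl <;> rcases z2 a1 with rfl | rfl <;>
    rcases z2 a2 with rfl | rfl <;> rcases z2 a3 with rfl | rfl <;>
    simp [z2_oo, z2_self] at hre him ⊢ <;>
    rcases z2 b0 with rfl | rfl <;> rcases z2 b1 with rfl | rfl <;>
    rcases z2 b2 with rfl | rfl <;> rcases z2 b3 with rfl | rfl <;>
    simp [z2_oo] at him ⊢

open Classical in
lemma claimB (x : Oc) (hre : ((nrd x).re : ZMod 2) = 1) :
    (Finset.univ.filter (fun k : Fin 6 => Dd (x * T k))).card = 4 := by
  obtain ⟨⟨a0, b0⟩, ⟨a1, b1⟩, ⟨a2, b2⟩, ⟨a3, b3⟩⟩ := x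
  rw [Finset.card_filter, Fin.sum_univ_six]
  simp only [Dd, s_dvd, T, Matrix.cons_val, mul_x3]
  simp [nrd, s, z2_two] at hre  ⊢
  generalize (a0 : ZMod 2) = a0 at *
  generalize (a1 : ZMod 2) = a1 at *
  generalize (a2 : ZMod 2) = a2 at *
  generalize (a3 : ZMod 2) = a3 at *
  rcases z2 a0 with rfl | rfl <;> rcases z2 a1 with rfl | rfl <;>
    rcases z2 a2 with rfl | rfl <;> rcases z2 a3 with rfl | rfl <;>
    simp [z2_oo] at hre ⊢

lemma Cs_dvd (x : Oc) : (∃ z, x = C s * z) ↔ s ∣ x.x0 ∧ s ∣ x.x1 ∧ s ∣ x.x2 ∧ s ∣ x.x3 := by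
  constructor
  · rintro ⟨z, rfl⟩
    simp [C]
  · rintro ⟨⟨a, ha⟩, ⟨b, hb⟩, ⟨c, hc⟩, ⟨d, hd⟩⟩
    exact ⟨⟨a, b, c, d⟩, by ext1 <;> simp [C, *]⟩

open Classical in
lemma claimC (x : Oc) (hre : ((nrd x).re : ZMod 2) = 0) :
    (Finset.univ.filter (fun k : Fin 3 => Dd (x * T (k.castLE (by norm_num))))).card
      = 1 + 2 * (if ∃ z, x = C s * z then 1 else 0) := by
  rw [Cs_dvd]
  obtain ⟨⟨a0, b0⟩, ⟨a1, b1⟩, ⟨a2, b2⟩, ⟨a3, b3⟩⟩ := x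
  rw [Finset.card_filter, Fin.sum_univ_three]
  simp only [Dd, s_dvd, T, Matrix.cons_val, mul_x3, Fin.castLE]
  simp [nrd, s, z2_two] at hre  ⊢
  generalize (a0 : ZMod 2) = a0 at *
  generalize (a1 : ZMod 2) = a1 at *
  generalize (a2 : ZMod 2) = a2 at *
  generalize (a3 : ZMod 2) = a3 at *
  rcases z2 a0 with rfl | rfl <;> rcases z2 a1 with rfl | rfl <;>
    rcases z2 a2 with rfl | rfl <;> rcases z2 a3 with rfl | rfl <;>
    simp [z2_oo] at hre ⊢

open Classical in
lemma card_Lam {m : Zs} (hre : (m.re : ZMod 2) = 1) (him : (m.im : ZMod 2) = 0) :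
    (S m).card = 6 * ((S m).filter Lam).card := by
  rw [← count_six, Finset.sum_congr rfl fun x hx => claimA x (by rw [mem_S.1 hx, hre])
    (by rw [mem_S.1 hx, him])]
  simp

open Classical in
lemma card_Dd_odd {m : Zs} (hre : (m.re : ZMod 2) = 1) :
    4 * (S m).card = 6 * ((S m).filter Dd).card := by
  rw [← count_six, Finset.sum_congr rfl fun x hx => claimB x (by rw [mem_S.1 hx, hre])]
  simp [mul_comm]

open Classical in
lemma card_Dd_even {m : Zs} (hre : (m.re : ZMod 2) = 0) :
    (S m).card + 2 * (Dv s m).card = 3 * ((S m).filter Dd).card := by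
  rw [← count_three, Finset.sum_congr rfl fun x hx => claimC x (by rw [mem_S.1 hx, hre])]
  rw [Finset.sum_add_distrib, ← Finset.mul_sum, Dv, Finset.card_filter]
  simp

end Oc
end FourSq

namespace FourSq
namespace Oc

open Classical in
lemma rep_Lam (m : Zs) :
    Nat.card {w : Fin 4 → Zs // ∑ i, w i ^ 2 = m} = ((S m).filter Lam).card := by
  rw [← Fintype.card_coe, ← Nat.card_eq_fintype_card]
  refine Nat.card_congr (Equiv.ofBijective (fun w => ⟨⟨w.1 0 - w.1 1 - w.1 2 + w.1 3,
    s * (w.1 1 - w.1 3), s * (w.1 2 - w.1 3), 2 * w.1 3⟩, ?_⟩) ⟨?_, ?_⟩)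
  · obtain ⟨w, hw⟩ := w
    rw [Finset.mem_filter, mem_S]
    refine ⟨?_, ⟨_, rfl⟩, ⟨_, rfl⟩, ⟨_, rfl⟩⟩
    refine Eq.trans ?_ hw
    rw [Fin.sum_univ_four]
    simp only [nrd]
    generalize w 0 = a, w 1 = b, w 2 = c, w 3 = d
    linear_combination ((b-d)^2+(c-d)^2+(a-b-c+d)*(b-d)+(a-b-c+d)*(c-d)+(a-b-c+d)*(2*d)
      +(b-d)*(c-d)+(b-d)*(2*d)+(c-d)*(2*d)) * s_mul
  · rintro ⟨w, hw⟩ ⟨w', hw'⟩ h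
    simp only [Subtype.mk.injEq, Oc.mk.injEq] at h
    obtain ⟨h0, h1, h2, h3⟩ := h
    have h3 := mul_left_cancel₀ two_ne h3
    have h1 := mul_left_cancel₀ s_ne h1
    have h2 := mul_left_cancel₀ s_ne h2
    rw [h3] at h1 h2 h0
    have h1 := sub_left_injective h1
    have h2 := sub_left_injective h2
    rw [h1, h2] at h0
    have h0 : w 0 = w' 0 := by linear_combination h0
    ext1
    funext i
    fin_cases i <;> assumption
  · rintro ⟨⟨x0, x1, x2, x3⟩, hx⟩
    rw [Finset.mem_filter, mem_S] at hx
    obtain ⟨hx, ⟨d, hd⟩, ⟨b, hb⟩, ⟨c, hc⟩⟩ := hx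
    simp only at hd hb hc
    subst hd hb hc
    refine ⟨⟨![x0 + b + c + d, b + d, c + d, d], ?_⟩, ?_⟩
    · rw [← hx, Fin.sum_univ_four]
      simp [nrd]
      linear_combination -((b)^2+(c)^2+(x0)*(b)+(x0)*(c)+(x0)*(2*d)
        +(b)*(c)+(b)*(2*d)+(c)*(2*d)) * s_mul
    · simp
      ring

lemma s_prime : Prime s := by
  refine ⟨s_ne, ?_, ?_⟩
  · rw [isUnit_iff']; decide
  · intro a b h
    rw [s_dvd] at h ⊢
    rw [s_dvd]
    simp [z2_two] at h
    exact h

open Classical in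
lemma rep_Dd (m : Zs) :
    Nat.card {w : Fin 4 → Zs // ∑ i, w i ^ 2 = 2 * m} = ((S m).filter Dd).card := by
  rw [← Fintype.card_coe, ← Nat.card_eq_fintype_card]
  have key : ∀ w : {w : Fin 4 → Zs // ∑ i, w i ^ 2 = 2 * m},
      ∃ y, w.1 0 - w.1 1 - w.1 2 + w.1 3 = s * y := by
    rintro ⟨w, hw⟩
    refine s_prime.dvd_of_dvd_pow (n := 2) ?_
    rw [Fin.sum_univ_four] at hw
    refine ⟨s * (m - w 0 * w 1 - w 0 * w 2 + w 0 * w 3 + w 1 * w 2 - w 1 * w 3 - w 2 * w 3), ?_⟩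
    rw [← mul_assoc, s_mul]
    linear_combination hw
  choose y hy using key
  refine Nat.card_congr (Equiv.ofBijective (fun w => ⟨⟨y w,
    w.1 1 - w.1 3, w.1 2 - w.1 3, s * w.1 3⟩, ?_⟩) ⟨?_, ?_⟩)
  · have hy := hy w
    obtain ⟨w, hw⟩ := w
    rw [Finset.mem_filter, mem_S]
    refine ⟨?_, ⟨_, rfl⟩⟩
    apply mul_left_cancel₀ two_ne
    refine Eq.trans ?_ hw
    rw [Fin.sum_univ_four]
    generalize y _ = y at *
    simp only [nrd]
    simp only at hy
    generalize w 0 = a, w 1 = b, w 2 = c, w 3 = d at *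
    have : a = s * y + b + c - d := by linear_combination hy
    subst this
    linear_combination (-y^2+2*d^2+2*s*y*d+2*d*(b-d+(c-d))) * s_mul
  · intro w w' h
    have hw := hy w
    have hw' := hy w'
    simp only [Subtype.mk.injEq, Oc.mk.injEq] at h
    obtain ⟨h0, h1, h2, h3⟩ := h
    have h3 := mul_left_cancel₀ s_ne h3
    rw [h3] at h1 h2
    have h1 := sub_left_injective h1
    have h2 := sub_left_injective h2
    rw [h0, ← hw', h1, h2, h3] at hw
    have h0 : w.1 0 = w'.1 0 := by linear_combination hw
    ext1
    funext i
    fin_cases i <;> assumption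
  · rintro ⟨⟨x0, x1, x2, x3⟩, hx⟩
    rw [Finset.mem_filter, mem_S] at hx
    obtain ⟨hx, ⟨d, hd⟩⟩ := hx
    simp only at hd
    subst hd
    refine ⟨⟨![s * x0 + x1 + x2 + d, x1 + d, x2 + d, d], ?_⟩, ?_⟩
    · rw [← hx, Fin.sum_univ_four]
      simp [nrd]
      linear_combination -(-x0^2+2*d^2+2*s*x0*d+2*d*(x1+x2)) * s_mul
    · have := hy ⟨![s * x0 + x1 + x2 + d, x1 + d, x2 + d, d], by
        rw [← hx, Fin.sum_univ_four]
        simp [nrd]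
        linear_combination -(-x0^2+2*d^2+2*s*x0*d+2*d*(x1+x2)) * s_mul⟩
      simp at this ⊢
      apply mul_left_cancel₀ s_ne
      rw [← this]; ring

lemma card_one_rep : Nat.card {w : Fin 4 → Zs // ∑ i, w i ^ 2 = 1} = 8 := by
  have e : {w : Fin 4 → Zs // ∑ i, w i ^ 2 = 1} ≃
      {w : Fin 4 → Fin 3 // ∑ i, ((w i : ℕ) - 1 : ℤ) ^ 2 = 1} := by
    refine Equiv.symm (Equiv.ofBijective (fun w => ⟨fun i => ⟨(w.1 i : ℕ) - 1, 0⟩, ?_⟩) ⟨?_, ?_⟩)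
    · obtain ⟨w, hw⟩ := w
      rw [Fin.sum_univ_four] at hw ⊢
      ext
      · simp [pow_two] at hw ⊢
        exact hw
      · simp [pow_two]
    · rintro ⟨w, hw⟩ ⟨w', hw'⟩ h
      simp only [Subtype.mk.injEq] at h ⊢
      funext i
      have := congrArg Zsqrtd.re (congrFun h i)
      simp at this
      ext; omega
    · rintro ⟨w, hw⟩
      have h := congrArg Zsqrtd.re hw
      have hb : ∀ i, (w i).re * (w i).re + 2 * ((w i).im * (w i).im) ≤ 1 := by
        intro i
        have : ∑ i, ((w i).re * (w i).re + 2 * ((w i).im * (w i).im)) = 1 := by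
          rw [Fin.sum_univ_four] at h ⊢
          simp [pow_two] at h
          linarith
        rw [← this]
        exact Finset.single_le_sum (f := fun i => (w i).re * (w i).re + 2 * ((w i).im * (w i).im))
          (fun i _ => by nlinarith [sq_nonneg (w i).re, sq_nonneg (w i).im]) (Finset.mem_univ i)
      have him : ∀ i, (w i).im = 0 := fun i => by
        by_contra hne
        have : 1 ≤ (w i).im * (w i).im := by
          have := mul_self_pos.2 hne
          omega
        nlinarith [hb i, mul_self_nonneg (w i).re]
      have hre : ∀ i, -1 ≤ (w i).re ∧ (w i).re ≤ 1 := fun i => by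
        have := hb i
        rw [him i] at this
        constructor <;> nlinarith
      have hcast : ∀ i, (((((w i).re + 1).toNat : ℕ) : ℤ)) = (w i).re + 1 := fun i => by
        have := hre i; omega
      refine ⟨⟨fun i => ⟨((w i).re + 1).toNat, by have := hre i; omega⟩, ?_⟩, ?_⟩
      · simp only [hcast]
        rw [Fin.sum_univ_four] at h ⊢
        simp [pow_two, him] at h ⊢
        exact h
      · ext i
        · simp [hcast]
        · simp [him]
  rw [Nat.card_congr e, Nat.card_eq_fintype_card]
  decide +kernel

lemma card_S_one : (S 1).card = 48 := by
  rw [card_Lam (by simp) (by simp), ← rep_Lam, card_one_rep]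

end Oc
end FourSq

namespace FourSq
section sigma
variable {K : Type*} [Field K] [NumberField K]

lemma div_finite {J : Ideal (𝓞 K)} (hJ : J ≠ ⊥) : {I : Ideal (𝓞 K) | I ∣ J}.Finite := by
  have := UniqueFactorizationMonoid.fintypeSubtypeDvd J hJ
  exact Set.finite_coe_iff.1 (Finite.of_fintype {x // x ∣ J})

open Classical in
/-- The divisors of a nonzero ideal. -/
noncomputable def Div (J : Ideal (𝓞 K)) : Finset (Ideal (𝓞 K)) :=
  if hJ : J ≠ ⊥ then (div_finite hJ).toFinset else ∅

lemma mem_Div {I J : Ideal (𝓞 K)} (hJ : J ≠ ⊥) : I ∈ Div J ↔ I ∣ J := by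
  simp [Div, hJ]

/-- The sum of norms of divisors. -/
noncomputable def sig (J : Ideal (𝓞 K)) : ℕ := ∑ I ∈ Div J, absNorm I

lemma sig_top : sig (⊤ : Ideal (𝓞 K)) = 1 := by
  have : Div (⊤ : Ideal (𝓞 K)) = {⊤} := by
    ext I
    rw [mem_Div top_ne_bot, ← Ideal.one_eq_top, Finset.mem_singleton]
    exact ⟨fun h => by simpa using isUnit_of_dvd_one h, fun h => by rw [h]⟩
  rw [sig, this]; simp

lemma sum_image (P : Ideal (𝓞 K)) (hP : P ≠ ⊥) (D : Finset (Ideal (𝓞 K))) :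
    ∑ I ∈ D.map ⟨(P * ·), mul_right_injective₀ hP⟩, absNorm I = absNorm P * ∑ I ∈ D, absNorm I := by
  rw [Finset.sum_map, Finset.mul_sum]
  simp

open Classical in
lemma Div_mul {P J : Ideal (𝓞 K)} (hP : Prime P) (hJ : J ≠ ⊥) :
    Div (P * J) = Div J ∪ (Div J).map ⟨(P * ·), mul_right_injective₀ hP.ne_zero⟩ := by
  ext I
  rw [mem_Div (mul_ne_zero hP.ne_zero hJ), Finset.mem_union, mem_Div hJ, Finset.mem_map]
  constructor
  · rintro ⟨A, hA⟩
    rcases hP.dvd_or_dvd (⟨J, hA.symm⟩ : P ∣ I * A) with ⟨I', rfl⟩ | ⟨A', rfl⟩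
    · right
      refine ⟨I', (mem_Div hJ).2 ⟨A, ?_⟩, rfl⟩
      rw [mul_assoc] at hA
      exact mul_left_cancel₀ hP.ne_zero hA
    · left
      refine ⟨A', ?_⟩
      rw [mul_left_comm] at hA
      exact mul_left_cancel₀ hP.ne_zero hA
  · rintro (h | ⟨I', hI', rfl⟩)
    · exact h.mul_left P
    · exact mul_dvd_mul_left P ((mem_Div hJ).1 hI')

open Classical in
lemma sig_mul {P J : Ideal (𝓞 K)} (hP : Prime P) (hJ : J ≠ ⊥) :
    sig (P * (P * J)) + absNorm P * sig J = (1 + absNorm P) * sig (P * J) := by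
  have h := Finset.sum_union_inter (s₁ := Div (P * J))
    (s₂ := (Div (P * J)).map ⟨(P * ·), mul_right_injective₀ hP.ne_zero⟩) (f := fun I => absNorm I)
  have hPJ : P * J ≠ ⊥ := mul_ne_zero hP.ne_zero hJ
  have hi : Div (P * J) ∩ (Div (P * J)).map ⟨(P * ·), mul_right_injective₀ hP.ne_zero⟩
      = (Div J).map ⟨(P * ·), mul_right_injective₀ hP.ne_zero⟩ := by
    ext I
    rw [Finset.mem_inter, mem_Div hPJ, Finset.mem_map, Finset.mem_map]
    constructor
    · rintro ⟨h, I', h', rfl⟩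
      exact ⟨I', (mem_Div hJ).2 ((mul_dvd_mul_iff_left hP.ne_zero).1 h), rfl⟩
    · rintro ⟨I', h', rfl⟩
      rw [mem_Div hJ] at h'
      exact ⟨mul_dvd_mul_left P h', I', (mem_Div hPJ).2 (h'.mul_left P), rfl⟩
  rw [← Div_mul hP hPJ, hi, sum_image _ hP.ne_zero, sum_image _ hP.ne_zero] at h
  simp only [sig]
  rw [h]; ring

open Classical in
lemma sig_mul' {P J : Ideal (𝓞 K)} (hP : Prime P) (hJ : J ≠ ⊥) (hd : ¬ P ∣ J) :
    sig (P * J) = (1 + absNorm P) * sig J := by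
  have h := Finset.sum_union_inter (s₁ := Div J)
    (s₂ := (Div J).map ⟨(P * ·), mul_right_injective₀ hP.ne_zero⟩) (f := fun I => absNorm I)
  have hi : Div J ∩ (Div J).map ⟨(P * ·), mul_right_injective₀ hP.ne_zero⟩ = ∅ := by
    rw [Finset.eq_empty_iff_forall_notMem]
    intro I
    rw [Finset.mem_inter, mem_Div hJ, Finset.mem_map]
    rintro ⟨h, I', h', rfl⟩
    exact hd ((dvd_mul_right P I').trans h)
  rw [← Div_mul hP hJ, hi, Finset.sum_empty, add_zero, sum_image _ hP.ne_zero] at h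
  simp only [sig]
  rw [h]; ring

lemma finsum_div {J : Ideal (𝓞 K)} (hJ : J ≠ ⊥) :
    ∑ᶠ I ∈ {I : Ideal (𝓞 K) | I ≠ ⊥ ∧ I ∣ J}, (absNorm I : ℤ) = sig J := by
  rw [sig, Nat.cast_sum, ← finsum_mem_coe_finset]
  refine finsum_mem_congr (Set.ext fun I => ?_) fun _ _ => rfl
  simp only [Set.mem_ofPred_eq, Finset.mem_coe, mem_Div hJ]
  exact ⟨fun h => h.2, fun h => ⟨fun h0 => hJ (by rw [h0] at h; exact zero_dvd_iff.1 h), h⟩⟩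

lemma finsum_div_mul {A J : Ideal (𝓞 K)} (hA : A ≠ ⊥) (hJ : J ≠ ⊥) :
    ∑ᶠ I ∈ {I : Ideal (𝓞 K) | I ≠ ⊥ ∧ I ∣ A * J ∧ A ∣ I}, (absNorm I : ℤ)
      = absNorm A * sig J := by
  rw [sig, ← Nat.cast_mul, ← sum_image A hA, Nat.cast_sum, ← finsum_mem_coe_finset]
  refine finsum_mem_congr (Set.ext fun I => ?_) fun _ _ => rfl
  simp only [Set.mem_ofPred_eq, Finset.mem_coe, Finset.mem_map]
  constructor
  · rintro ⟨_, h, I', rfl⟩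
    exact ⟨I', (mem_Div hJ).2 ((mul_dvd_mul_iff_left hA).1 h), rfl⟩
  · rintro ⟨I', h', rfl⟩
    rw [mem_Div hJ] at h'
    refine ⟨mul_ne_zero hA fun h0 => hJ (by rw [h0] at h'; exact zero_dvd_iff.1 h'),
      mul_dvd_mul_left A h', dvd_mul_right _ _⟩

lemma finsum_div_zero {A J : Ideal (𝓞 K)} (hA : ¬ A ∣ J) :
    ∑ᶠ I ∈ {I : Ideal (𝓞 K) | I ≠ ⊥ ∧ I ∣ J ∧ A ∣ I}, (absNorm I : ℤ) = 0 := by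
  have : {I : Ideal (𝓞 K) | I ≠ ⊥ ∧ I ∣ J ∧ A ∣ I} = ∅ := by
    rw [Set.eq_empty_iff_forall_notMem]
    rintro I ⟨_, h1, h2⟩
    exact hA (h2.trans h1)
  rw [this, finsum_mem_empty]

end sigma
end FourSq

namespace FourSq
section main
variable {K : Type*} [Field K] [NumberField K] (e : Zs ≃+* 𝓞 K)

/-- The principal ideal of `𝓞 K` attached to an element of `ℤ[√2]`. -/
noncomputable def sp (m : Zs) : Ideal (𝓞 K) := Ideal.span {e m}

lemma sp_mul (a b : Zs) : sp e (a * b) = sp e a * sp e b := by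
  rw [sp, sp, sp, Ideal.span_singleton_mul_span_singleton, map_mul]

lemma sp_dvd (a b : Zs) : sp e a ∣ sp e b ↔ a ∣ b := by
  rw [sp, sp, Ideal.dvd_iff_le, Ideal.span_singleton_le_span_singleton]
  exact map_dvd_iff e

lemma sp_ne {a : Zs} (h : a ≠ 0) : sp e a ≠ ⊥ := by
  rw [sp, Ne, Ideal.span_singleton_eq_bot]
  simpa using h

lemma sp_prime {p : Zs} (h : Prime p) : Prime (sp e p) := by
  rw [sp, Ideal.prime_span_singleton_iff]
  exact (MulEquiv.prime_iff e).2 h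

open Oc

lemma card_S_prime {p : Zs} (hp : Prime p) (hpT : TP p) :
    (S p).card = 48 * (absNorm (sp e p) + 1) := by
  have hne := sp_ne e hp.ne_zero
  have h1 : (sp e p).IsPrime := Ideal.isPrime_of_prime (sp_prime e hp)
  have h2 : (sp e p).IsMaximal := h1.isMaximal hne
  let _ := Ideal.Quotient.field (sp e p)
  have h3 : Finite (𝓞 K ⧸ sp e p) := Ideal.finiteQuotientOfFreeOfNeBot _ hne
  rw [card_prime hp hpT ((Ideal.Quotient.mk (sp e p)).comp (e : Zs →+* 𝓞 K))
    (Ideal.Quotient.mk_surjective.comp e.surjective), card_S_one, absNorm_apply,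
    Submodule.cardQuot_apply]
  intro x
  rw [RingHom.comp_apply, Ideal.Quotient.eq_zero_iff_mem, sp, Ideal.mem_span_singleton]
  exact map_dvd_iff e

lemma card_S (m : Zs) (hm : TP m) : (S m).card = 48 * sig (sp e m) := by
  induction hN : m.norm.natAbs using Nat.strong_induction_on generalizing m with
  | _ N ih =>
    by_cases hu : IsUnit m
    · rw [S_unit hm hu, card_S_one, sp, Ideal.span_singleton_eq_top.2 (hu.map e), sig_top]
    · obtain ⟨p, n, hp, hpT, hn, rfl⟩ := exists_prime hm hu
      have hlt : ∀ a b : Zs, TP b → ¬ IsUnit a → TP a → b.norm.natAbs < (a * b).norm.natAbs := by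
        intro a b hb ha haT
        rw [isUnit_iff'] at ha
        rw [Zsqrtd.norm_mul, Int.natAbs_mul]
        have h1 := haT.2
        have h2 := hb.2
        have h3 : 1 < a.norm.natAbs := by omega
        have h4 : 0 < b.norm.natAbs := by omega
        exact lt_mul_left h4 h3
      have hl := hlt p n hn hp.not_isUnit hpT
      have hR := ih _ (hN ▸ hl) n hn rfl
      have H := hecke (m := n) hp hpT
      rw [card_S_one, card_S_prime e hp hpT] at H
      by_cases hd : p ∣ n
      · obtain ⟨n', rfl⟩ := hd
        have hn' : TP n' := TP.of_mul (by rwa [mul_comm] at hn) hpT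
        have hR' := ih _ (hN ▸ (hlt p n' hn' hp.not_isUnit hpT).trans hl) n' hn' rfl
        rw [← mul_assoc, Dv_card hp.ne_zero, hR, hR'] at H
        have hs := sig_mul (sp_prime e hp) (sp_ne e hn'.ne)
        rw [← sp_mul, ← sp_mul] at hs
        rw [← mul_assoc] at hs ⊢
        generalize absNorm (sp e p) = q at *
        nlinarith
      · rw [Dv_zero hp.ne_zero hd, hR] at H
        have hs := sig_mul' (sp_prime e hp) (sp_ne e hn.ne) (by rwa [sp_dvd])
        rw [← sp_mul] at hs
        generalize absNorm (sp e p) = q at *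
        nlinarith

lemma norm_two (hdeg : Module.finrank ℚ K = 2) : absNorm (sp e 2) = 4 := by
  have : e 2 = algebraMap ℤ (𝓞 K) 2 := by
    rw [map_ofNat e 2]; simp
  rw [sp, absNorm_span_singleton, this, Algebra.norm_algebraMap, RingOfIntegers.rank, hdeg]
  rfl

lemma norm_s (hdeg : Module.finrank ℚ K = 2) : absNorm (sp e s) = 2 := by
  have h := norm_two e hdeg
  rw [← s_mul, sp_mul, map_mul] at h
  nlinarith

lemma norm_four (hdeg : Module.finrank ℚ K = 2) : absNorm (sp e 4) = 16 := by
  rw [show (4 : Zs) = 2 * 2 by norm_num, sp_mul, map_mul, norm_two e hdeg]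

lemma TP_two : TP 2 := by constructor <;> simp [norm_def']

lemma final (hdeg : Module.finrank ℚ K = 2) (m : Zs) (hm : TP m) (him : (m.im : ZMod 2) = 0) :
    (Nat.card {w : Fin 4 → Zs // ∑ i, w i ^ 2 = m} : ℤ) =
      8 * (∑ᶠ I ∈ {I : Ideal (𝓞 K) | I ≠ ⊥ ∧ I ∣ sp e m}, (Ideal.absNorm I : ℤ))
        - 6 * (∑ᶠ I ∈ {I : Ideal (𝓞 K) | I ≠ ⊥ ∧ I ∣ sp e m ∧ sp e 2 ∣ I}, (Ideal.absNorm I : ℤ))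
        + 4 * (∑ᶠ I ∈ {I : Ideal (𝓞 K) | I ≠ ⊥ ∧ I ∣ sp e m ∧ sp e 4 ∣ I},
            (Ideal.absNorm I : ℤ)) := by
  have hs' := sp_prime e s_prime
  have h42 : (4 : Zs) = 2 * 2 := by norm_num
  rw [finsum_div (sp_ne e hm.ne)]
  rcases z2 m.re with hre | hre
  · obtain ⟨m, rfl⟩ := (two_dvd m).2 ⟨hre, him⟩
    have hm1 : TP m := TP.of_mul (by rwa [mul_comm] at hm) TP_two
    rw [rep_Dd, sp_mul, finsum_div_mul (sp_ne e two_ne) (sp_ne e hm1.ne), norm_two e hdeg]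
    have hR := card_S e m hm1
    have hA := sig_mul hs' (sp_ne e hm1.ne)
    rw [← mul_assoc, ← sp_mul, s_mul, norm_s e hdeg] at hA
    rcases z2 m.re with hr | hr
    · have hD := card_Dd_even hr
      obtain ⟨m', rfl⟩ := (s_dvd m).2 hr
      by_cases hd : s ∣ m'
      · obtain ⟨n, rfl⟩ := hd
        have hn0 : n ≠ 0 := by rintro rfl; simpa using hm1.ne
        have hss : s * (s * n) = 2 * n := by rw [← mul_assoc, s_mul]
        have e2 : sp e 2 = sp e s * sp e s := by rw [← s_mul, sp_mul]
        rw [← mul_assoc s s n, Dv_card s_ne] at hD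
        have hn : TP n := TP.of_mul (by rwa [hss, mul_comm] at hm1) TP_two
        have hRn := card_S e n hn
        have hB := sig_mul hs' (sp_ne e (mul_ne_zero s_ne hn0))
        have hC := sig_mul hs' (sp_ne e hn0)
        rw [norm_s e hdeg] at hB hC
        have h3 : sp e 2 * sp e (s * (s * n)) = sp e 4 * sp e n := by
          rw [← sp_mul, ← sp_mul, hss, h42, mul_assoc]
        rw [show ∑ᶠ I ∈ {I : Ideal (𝓞 K) | I ≠ ⊥ ∧ I ∣ sp e 2 * sp e (s * (s * n)) ∧ sp e 4 ∣ I},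
          (Ideal.absNorm I : ℤ) = 16 * sig (sp e n) by
            rw [h3, finsum_div_mul (sp_ne e (by rw [h42]; exact mul_ne_zero two_ne two_ne)) (sp_ne e hn0),
              norm_four e hdeg]; rfl]
        rw [mul_assoc s s n] at hD
        rw [e2] at hA ⊢
        simp only [sp_mul, mul_assoc] at *
        push_cast
        omega
      · have hm0 : m' ≠ 0 := by rintro rfl; simpa using hm1.ne
        rw [Dv_zero s_ne hd] at hD
        have e2 : sp e 2 = sp e s * sp e s := by rw [← s_mul, sp_mul]
        have hB := sig_mul hs' (sp_ne e hm0)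
        have hC := sig_mul' hs' (sp_ne e hm0) (by rwa [sp_dvd])
        rw [norm_s e hdeg] at hB hC
        rw [finsum_div_zero (A := sp e 4)]
        · rw [e2] at hA ⊢
          simp only [sp_mul, mul_assoc] at *
          push_cast
          omega
        · rw [← sp_mul, sp_dvd, h42, mul_dvd_mul_iff_left two_ne, ← s_mul,
            mul_dvd_mul_iff_left s_ne]
          exact hd
    · have hD := card_Dd_odd hr
      have hsd : ¬ s ∣ m := by rw [s_dvd, hr]; exact one_ne_zero
      have hB := sig_mul' hs' (sp_ne e hm1.ne) (by rwa [sp_dvd])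
      rw [← sp_mul, finsum_div_zero]
      · rw [norm_s e hdeg] at hB
        rw [sp_mul]
        push_cast
        omega
      · rw [sp_dvd, h42, mul_dvd_mul_iff_left two_ne]
        exact fun h => hsd (dvd_trans ⟨s, s_mul.symm⟩ h)
  · have h2 : ¬ (2 : Zs) ∣ m := by rw [two_dvd, hre]; simp
    have hL := card_Lam hre him
    rw [finsum_div_zero (by rwa [sp_dvd]), finsum_div_zero (by
      rw [sp_dvd, h42]; exact fun h => h2 (dvd_of_mul_left_dvd h)), rep_Lam]
    rw [card_S e m hm] at hL
    omega
end main
end FourSq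

namespace FourSq
section transfer
variable {K : Type*} [Field K] [NumberField K]

lemma not_sq_two (q : ℚ) : q * q ≠ 2 := by
  intro h
  have h1 : IsSquare (2 : ℚ) := ⟨q, h.symm⟩
  rw [Rat.isSquare_ofNat_iff] at h1
  obtain ⟨n, hn⟩ := h1
  have : n < 2 := by nlinarith
  interval_cases n <;> simp at hn

lemma span_r (hdeg : Module.finrank ℚ K = 2) (r : K) (hr : r * r = 2) (z : K) :
    ∃ a b : ℚ, z = a + b * r := by
  have hli : LinearIndependent ℚ ![(1 : K), r] := by
    rw [LinearIndependent.pair_iff]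
    intro a b h
    rw [Algebra.smul_def, Algebra.smul_def, mul_one] at h
    simp only [eq_ratCast] at h
    have hb : b = 0 := by
      by_contra hb
      have hb' : (b : K) ≠ 0 := by exact_mod_cast hb
      have h1 : r = ((-a / b : ℚ) : K) := by
        push_cast
        field_simp
        linear_combination h
      rw [h1] at hr
      exact not_sq_two _ (by exact_mod_cast hr)
    subst hb
    simp at h
    exact ⟨h, rfl⟩
  have hsp := hli.span_eq_top_of_card_eq_finrank' (by simp [hdeg])
  have hz : z ∈ Submodule.span ℚ (Set.range ![(1 : K), r]) := by rw [hsp]; trivial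
  simp only [Matrix.range_cons, Matrix.range_empty, Set.union_empty, Set.singleton_union] at hz
  obtain ⟨a, b, h⟩ := Submodule.mem_span_pair.1 hz
  refine ⟨a, b, ?_⟩
  rw [← h, Algebra.smul_def, Algebra.smul_def, mul_one]
  simp

lemma exists_equiv (hdeg : Module.finrank ℚ K = 2) (r : K) (hr : r * r = 2) :
    ∃ e : Zs ≃+* 𝓞 K, ∀ t : ℝ, t * t = 2 →
      ∃ φ : K →+* ℝ, ∀ x : Zs, φ (e x : K) = x.re + x.im * t := by
  let g : Zs →+* K := Zsqrtd.lift ⟨r, by simpa using hr⟩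
  have hg : ∀ x : Zs, g x = x.re + x.im * r := fun x => rfl
  have hginj : Function.Injective g := Zsqrtd.lift_injective _ nonsq
  let _ : Algebra Zs K := g.toAlgebra
  have hga : ∀ x : Zs, algebraMap Zs K x = x.re + x.im * r := hg
  have hfs : FaithfulSMul Zs K := (faithfulSMul_iff_algebraMap_injective Zs K).2 hginj
  have hfr : IsFractionRing Zs K := by
    apply IsFractionRing.of_field
    intro z
    obtain ⟨a, b, rfl⟩ := span_r hdeg r hr z
    refine ⟨⟨a.num * b.den, b.num * a.den⟩, ⟨a.den * b.den, 0⟩, ?_⟩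
    rw [hga, hga]
    have ha : (a.den : K) ≠ 0 := by exact_mod_cast a.den_ne_zero
    have hb : (b.den : K) ≠ 0 := by exact_mod_cast b.den_ne_zero
    have h1 : (a : K) = a.num / a.den := Rat.cast_def a
    have h2 : (b : K) = b.num / b.den := Rat.cast_def b
    rw [h1, h2]
    push_cast
    field_simp
    ring
  have hri : IsIntegral ℤ r := by
    refine IsIntegral.of_pow (n := 2) (by norm_num) ?_
    rw [pow_two, hr]
    simpa using (isIntegral_algebraMap (R := ℤ) (A := K) (x := (2 : ℤ)))
  obtain ⟨r', hrr⟩ : ∃ r' : 𝓞 K, algebraMap (𝓞 K) K r' = r := ⟨⟨r, hri⟩, rfl⟩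
  have hr' : r' * r' = ((2 : ℤ) : 𝓞 K) := by
    apply RingOfIntegers.ext
    change algebraMap (𝓞 K) K (r' * r') = algebraMap (𝓞 K) K ((2 : ℤ) : 𝓞 K)
    rw [map_mul, hrr, hr, map_intCast]; norm_num
  let e0 : Zs →+* 𝓞 K := Zsqrtd.lift ⟨r', hr'⟩
  have he0 : ∀ x : Zs, ((e0 x : 𝓞 K) : K) = algebraMap Zs K x := by
    intro x
    rw [hga]
    change ((((x.re : 𝓞 K) + (x.im : 𝓞 K) * r' : 𝓞 K)) : K) = _
    simp [hrr]
  have hinj : Function.Injective e0 := Zsqrtd.lift_injective _ nonsq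
  have hsurj : Function.Surjective e0 := by
    intro z
    have h1 : IsIntegral ℤ (z : K) := RingOfIntegers.isIntegral_coe z
    have h2 : IsIntegral Zs (z : K) := h1.tower_top
    obtain ⟨y, hy⟩ := IsIntegrallyClosed.isIntegral_iff.1 h2
    exact ⟨y, RingOfIntegers.ext (by rw [he0, hy])⟩
  have hbij : Function.Bijective e0 := ⟨hinj, hsurj⟩
  refine ⟨RingEquiv.ofBijective e0 hbij, fun t ht => ?_⟩
  have hg2 : Function.Injective (Zsqrtd.lift (d := 2) (R := ℝ) ⟨t, by simpa using ht⟩) :=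
    Zsqrtd.lift_injective _ nonsq
  refine ⟨IsFractionRing.lift hg2, fun x => ?_⟩
  rw [RingEquiv.ofBijective_apply, he0, IsFractionRing.lift_algebraMap]
  rfl

lemma TP_of (m : Zs) (h : ∀ t : ℝ, t * t = 2 → 0 < (m.re : ℝ) + m.im * t) : TP m := by
  have h0 : √2 * √2 = (2 : ℝ) := Real.mul_self_sqrt (by norm_num)
  have h1 := h (√2) h0
  have h2 := h (-√2) (by linarith)
  constructor
  · have : (0 : ℝ) < m.re := by linarith
    exact_mod_cast this
  · rw [norm_def']
    have : (0 : ℝ) < m.re ^ 2 - 2 * m.im ^ 2 := by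
      have := mul_pos h1 h2
      nlinarith
    exact_mod_cast this

end transfer
end FourSq

/-- for `K = ℚ(√2)` (a real quadratic field containing `√2`) and
`m ∈ O_K` totally positive and locally represented by the sum of four squares
(representable modulo every nonzero ideal), the number of representations of
`m` as a sum of four squares is
`8·Σ_{(0)≠(d)|(m)} N(d) − 6·Σ_{(2)|(d)|(m)} N(d) + 4·Σ_{(4)|(d)|(m)} N(d)`. -/
theorem four_squares_count_sqrt2
    (K : Type*) [Field K] [NumberField K]
    (hdeg : Module.finrank ℚ K = 2) (hreal : Nonempty (K →+* ℝ))
    (h2 : ∃ r : K, r ^ 2 = 2)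
    (m : 𝓞 K) (hm : ∀ φ : K →+* ℝ, 0 < φ (m : K))
    (hloc : ∀ I : Ideal (𝓞 K), I ≠ ⊥ →
      ∃ x : Fin 4 → 𝓞 K, (∑ i, x i ^ 2) - m ∈ I) :
    (Nat.card {x : Fin 4 → 𝓞 K // (∑ i, x i ^ 2) = m} : ℤ) =
      8 * (∑ᶠ I ∈ {I : Ideal (𝓞 K) | I ≠ ⊥ ∧ I ∣ Ideal.span {m}},
            (Ideal.absNorm I : ℤ))
        - 6 * (∑ᶠ I ∈ {I : Ideal (𝓞 K) | I ≠ ⊥ ∧ I ∣ Ideal.span {m} ∧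
            Ideal.span {(2 : 𝓞 K)} ∣ I}, (Ideal.absNorm I : ℤ))
        + 4 * (∑ᶠ I ∈ {I : Ideal (𝓞 K) | I ≠ ⊥ ∧ I ∣ Ideal.span {m} ∧
            Ideal.span {(4 : 𝓞 K)} ∣ I}, (Ideal.absNorm I : ℤ)) := by
  obtain ⟨r, hr⟩ := h2
  rw [pow_two] at hr
  obtain ⟨e, he⟩ := FourSq.exists_equiv hdeg r hr
  obtain ⟨m, rfl⟩ := e.surjective m
  have hTP : FourSq.TP m := by
    apply FourSq.TP_of
    intro t ht
    obtain ⟨φ, hφ⟩ := he t ht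
    rw [← hφ]
    exact hm φ
  have e2 : e 2 = 2 := map_ofNat e 2
  have e4 : e 4 = 4 := map_ofNat e 4
  have him : (m.im : ZMod 2) = 0 := by
    obtain ⟨x, hx⟩ := hloc (FourSq.sp e 2) (FourSq.sp_ne e FourSq.two_ne)
    rw [FourSq.sp, Ideal.mem_span_singleton] at hx
    obtain ⟨y, hy⟩ : ∃ y : Fin 4 → Zs, ∀ i, x i = e (y i) :=
      ⟨fun i => e.symm (x i), fun i => by simp⟩
    have h1 : e 2 ∣ e ((∑ i, y i ^ 2) - m) := by
      simpa [hy] using hx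
    rw [map_dvd_iff e, FourSq.two_dvd] at h1
    have h2 := h1.2
    rw [Fin.sum_univ_four] at h2
    simp [pow_two] at h2
    have h3 : ∀ a b : ZMod 2, a * b + b * a = 0 := by decide
    simpa [h3] using h2
  have hf := FourSq.final e hdeg m hTP him
  rw [FourSq.sp, FourSq.sp, FourSq.sp, e2, e4] at hf
  rw [← hf]
  congr 1
  refine Nat.card_congr (Equiv.subtypeEquiv (Equiv.arrowCongr (Equiv.refl _) e.symm.toEquiv) ?_)
  intro w
  rw [← e.injective.eq_iff]
  simp
end

section
/- Let p be an odd prime and m an integer with ord_p(m) = 1. Then β_p(m)·p²/(p²−1) = 1 + 1/p, where β_p(m) = lim_{ν→∞} #{x ∈ (ℤ/p^ν)⁴ : Σxᵢ² ≡ m (mod p^ν)}/p^{3ν}. -/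
open Filter

/-- Lifting a representation of `-1` as a sum of two squares to prime powers. -/
lemma exists_sq_add_sq (p : ℕ) (hp : p.Prime) (hodd : p ≠ 2) (n : ℕ) :
    ∃ a b : ℤ, ¬ (p : ℤ) ∣ a ∧ (p : ℤ) ^ (n + 1) ∣ a ^ 2 + b ^ 2 + 1 := by
  haveI := Fact.mk hp
  induction n with
  | zero =>
    obtain ⟨a, b, hab⟩ := ZMod.sq_add_sq p (-1)
    have key : ∀ a b : ZMod p, a ≠ 0 → a ^ 2 + b ^ 2 = -1 →
        ∃ a b : ℤ, ¬ (p : ℤ) ∣ a ∧ (p : ℤ) ^ (0 + 1) ∣ a ^ 2 + b ^ 2 + 1 := by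
      intro a b ha h
      refine ⟨a.val, b.val, ?_, ?_⟩
      · rw [← ZMod.intCast_zmod_eq_zero_iff_dvd]
        simpa using ha
      · rw [zero_add, pow_one, ← ZMod.intCast_zmod_eq_zero_iff_dvd]
        push_cast
        simp [h]
    by_cases ha : a = 0
    · refine key b a ?_ (by rw [← hab]; ring)
      rintro rfl
      simp [ha] at hab
    · exact key a b ha hab
  | succ n ih =>
    obtain ⟨a, b, ha, k, hk⟩ := ih
    have hpr : Prime (p : ℤ) := Nat.prime_iff_prime_int.mp hp
    have h2 : ¬ (p : ℤ) ∣ 2 * a := by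
      intro h
      rcases hpr.dvd_or_dvd h with h | h
      · have h3 : p ∣ 2 := by exact_mod_cast h
        exact hodd ((Nat.prime_dvd_prime_iff_eq hp Nat.prime_two).mp h3)
      · exact ha h
    have hcop : IsCoprime (2 * a) (p : ℤ) := ((Prime.coprime_iff_not_dvd hpr).mpr h2).symm
    obtain ⟨s, t, hst⟩ := hcop
    refine ⟨a + p ^ (n + 1) * (-k * s), b, ?_, ?_⟩
    · intro h
      apply ha
      have h1 : (p : ℤ) ∣ p ^ (n + 1) * (-k * s) :=
        Dvd.dvd.mul_right (dvd_pow_self _ (Nat.succ_ne_zero n)) _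
      exact (dvd_add_left h1).mp h
    · refine ⟨k * t + p ^ n * (k * s) ^ 2, ?_⟩
      have : (a + (p : ℤ) ^ (n + 1) * (-k * s)) ^ 2 + b ^ 2 + 1
        = (a ^ 2 + b ^ 2 + 1) + p ^ (n + 1) * (- k * (s * (2 * a)) )
          + (p ^ (n + 1)) ^ 2 * (k * s) ^ 2 := by ring
      have e : s * (2 * a) = 1 - t * p := by linarith
      rw [this, hk, e]
      ring

section count
variable {R : Type*} [CommRing R] [Fintype R] [DecidableEq R]

/-- Counting matrices with given determinant, whose determinant is not in the
square of the ideal of nonunits. -/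
lemma card_det (m : R) (U : Finset R) (q : Finset R)
    (hU : ∀ x, x ∈ U ↔ IsUnit x) (hq : ∀ x, x ∈ q ↔ ¬ IsUnit x)
    (hadd : ∀ x y : R, ¬ IsUnit x → ¬ IsUnit y → ¬ IsUnit (x + y))
    (hm : ¬ IsUnit m)
    (hm2 : ∀ a b c d : R, ¬ IsUnit a → ¬ IsUnit b → ¬ IsUnit c → ¬ IsUnit d →
      a * d - b * c ≠ m) :
    (Finset.univ.filter (fun x : R × R × R × R =>
      x.1 * x.2.2.2 - x.2.1 * x.2.2.1 = m)).card
      = U.card * (Fintype.card R + q.card) ^ 2 := by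
  classical
  have inv : ∀ x : R, IsUnit x → x * Ring.inverse x = 1 := fun x hx =>
    Ring.mul_inverse_cancel x hx
  have hmul : ∀ x y : R, ¬ IsUnit x → ¬ IsUnit (x * y) := fun x y hx h =>
    hx (isUnit_of_mul_isUnit_left h)
  have hmul' : ∀ x y : R, ¬ IsUnit y → ¬ IsUnit (x * y) := fun x y hx h =>
    hx (isUnit_of_mul_isUnit_right h)
  have hneg : ∀ x : R, ¬ IsUnit x → ¬ IsUnit (-x) := fun x hx h => hx (by simpa using h.neg)
  set S := Finset.univ.filter (fun x : R × R × R × R =>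
      x.1 * x.2.2.2 - x.2.1 * x.2.2.1 = m) with hS
  have e1 := Finset.card_filter_add_card_filter_not (s := S) (fun x => IsUnit x.1)
  have e2 := Finset.card_filter_add_card_filter_not
    (s := S.filter (fun x => ¬ IsUnit x.1)) (fun x => IsUnit x.2.1)
  have e3 := Finset.card_filter_add_card_filter_not
    (s := (S.filter (fun x => ¬ IsUnit x.1)).filter (fun x => ¬ IsUnit x.2.1))
    (fun x => IsUnit x.2.2.2)
  have c1 : (S.filter (fun x => IsUnit x.1)).card
      = (U ×ˢ (Finset.univ : Finset R) ×ˢ (Finset.univ : Finset R)).card := by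
    refine Finset.card_nbij' (fun x => (x.1, x.2.1, x.2.2.1))
      (fun y => (y.1, y.2.1, y.2.2, Ring.inverse y.1 * (m + y.2.1 * y.2.2))) ?_ ?_ ?_ ?_
    · rintro ⟨a, b, c, d⟩ h
      simp_all
    · rintro ⟨a, b, c⟩ h
      simp [hU] at h
      simp [hS, h]
      linear_combination (m + b * c) * inv a h
    · rintro ⟨a, b, c, d⟩ h
      simp [hS] at h
      simp
      linear_combination (-Ring.inverse a) * h.1 + d * inv a h.2
    · rintro ⟨a, b, c⟩ h
      simp
  have c2 : ((S.filter (fun x => ¬ IsUnit x.1)).filter (fun x => IsUnit x.2.1)).card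
      = (q ×ˢ U ×ˢ (Finset.univ : Finset R)).card := by
    refine Finset.card_nbij' (fun x => (x.1, x.2.1, x.2.2.2))
      (fun y => (y.1, y.2.1, Ring.inverse y.2.1 * (y.1 * y.2.2 - m), y.2.2)) ?_ ?_ ?_ ?_
    · rintro ⟨a, b, c, d⟩ h
      simp_all
    · rintro ⟨a, b, d⟩ h
      simp [hU, hq] at h
      simp [hS, h]
      linear_combination (m - a * d) * inv b h.2
    · rintro ⟨a, b, c, d⟩ h
      simp [hS] at h
      simp
      linear_combination (Ring.inverse b) * h.1.1 + c * inv b h.2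
    · rintro ⟨a, b, c⟩ h
      simp
  have c3 : (((S.filter (fun x => ¬ IsUnit x.1)).filter (fun x => ¬ IsUnit x.2.1)).filter
        (fun x => IsUnit x.2.2.2)).card
      = (q ×ˢ (Finset.univ : Finset R) ×ˢ U).card := by
    refine Finset.card_nbij' (fun x => (x.2.1, x.2.2.1, x.2.2.2))
      (fun y => (Ring.inverse y.2.2 * (m + y.1 * y.2.1), y.1, y.2.1, y.2.2)) ?_ ?_ ?_ ?_
    · rintro ⟨a, b, c, d⟩ h
      simp_all
    · rintro ⟨b, c, d⟩ h
      simp only [Finset.coe_product, Set.mem_prod, Finset.mem_coe, hU, hq] at h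
      have hn : ¬ IsUnit (Ring.inverse d * (m + b * c)) :=
        hmul' _ _ (hadd _ _ hm (hmul _ _ h.1))
      simp only [hS, Finset.coe_filter, Finset.mem_filter, Finset.mem_univ, true_and,
        Set.mem_setOf_eq]
      refine ⟨⟨⟨?_, hn⟩, h.1⟩, h.2.2⟩
      linear_combination (m + b * c) * inv d h.2.2
    · rintro ⟨a, b, c, d⟩ h
      simp [hS] at h
      simp
      linear_combination (-Ring.inverse d) * h.1.1.1 + a * inv d h.2
    · rintro ⟨a, b, c⟩ h
      simp
  have c4 : (((S.filter (fun x => ¬ IsUnit x.1)).filter (fun x => ¬ IsUnit x.2.1)).filter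
        (fun x => ¬ IsUnit x.2.2.2)).card
      = (q ×ˢ q ×ˢ U).card := by
    refine Finset.card_nbij' (fun x => (x.1, x.2.2.2, x.2.2.1))
      (fun y => (y.1, Ring.inverse y.2.2 * (y.1 * y.2.1 - m), y.2.2, y.2.1)) ?_ ?_ ?_ ?_
    · rintro ⟨a, b, c, d⟩ h
      simp [hS] at h
      simp only [Finset.coe_product, Set.mem_prod, Finset.mem_coe, hU, hq]
      refine ⟨h.1.1.2, h.2, ?_⟩
      by_contra hc
      exact hm2 a b c d h.1.1.2 h.1.2 hc h.2 h.1.1.1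
    · rintro ⟨a, d, c⟩ h
      simp only [Finset.coe_product, Set.mem_prod, Finset.mem_coe, hU, hq] at h
      have hn : ¬ IsUnit (Ring.inverse c * (a * d - m)) := by
        rw [sub_eq_add_neg]
        exact hmul' _ _ (hadd _ _ (hmul _ _ h.1) (hneg _ hm))
      simp only [hS, Finset.coe_filter, Finset.mem_filter, Finset.mem_univ, true_and,
        Set.mem_setOf_eq]
      refine ⟨⟨⟨?_, h.1⟩, hn⟩, h.2.1⟩
      linear_combination (m - a * d) * inv c h.2.2
    · rintro ⟨a, b, c, d⟩ h
      simp [hS] at h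
      have hc : IsUnit c := by
        by_contra hc
        exact hm2 a b c d h.1.1.2 h.1.2 hc h.2 h.1.1.1
      simp
      linear_combination (Ring.inverse c) * h.1.1.1 + b * inv c hc
    · rintro ⟨a, b, c⟩ h
      simp
  rw [c3, c4] at e3
  rw [c2, ← e3] at e2
  rw [c1, ← e2] at e1
  rw [← e1]
  simp only [Finset.card_product, Finset.card_univ]
  ring

/-- The sum of four squares is equivalent to the determinant. -/
lemma card_four_sq (m u v i2 : R) (huv : u ^ 2 + v ^ 2 = -1) (h2 : 2 * i2 = 1) :
    Nat.card {x : Fin 4 → R // (∑ i, x i ^ 2) = m}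
      = (Finset.univ.filter (fun x : R × R × R × R =>
        x.1 * x.2.2.2 - x.2.1 * x.2.2.1 = m)).card := by
  rw [Nat.card_eq_fintype_card, Fintype.card_subtype]
  refine Finset.card_nbij'
    (fun x => (x 0 - (u * x 2 - v * x 3), (v * x 2 + u * x 3) - x 1,
      (v * x 2 + u * x 3) + x 1, x 0 + (u * x 2 - v * x 3)))
    (fun y => ![i2 * (y.1 + y.2.2.2), i2 * (y.2.2.1 - y.2.1),
      -(u * (i2 * (y.2.2.2 - y.1)) + v * (i2 * (y.2.1 + y.2.2.1))),
      -(u * (i2 * (y.2.1 + y.2.2.1)) - v * (i2 * (y.2.2.2 - y.1)))]) ?_ ?_ ?_ ?_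
  · intro x h
    simp [Fin.sum_univ_four] at h ⊢
    linear_combination h - (x 2 ^ 2 + x 3 ^ 2) * huv
  · rintro ⟨a, b, c, d⟩ h
    simp [Fin.sum_univ_four] at h ⊢
    linear_combination h + i2 ^ 2 * ((d - a) ^ 2 + (b + c) ^ 2) * huv
      + (a * d - b * c) * (2 * i2 + 1) * h2
  · intro x h
    ext i
    fin_cases i
    · simp
      linear_combination x 0 * h2
    · simp
      linear_combination x 1 * h2
    · simp
      linear_combination x 2 * h2 - 2 * i2 * x 2 * huv
    · simp
      linear_combination x 3 * h2 - 2 * i2 * x 3 * huv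
  · rintro ⟨a, b, c, d⟩ h
    simp
    refine ⟨?_, ?_, ?_, ?_⟩
    · linear_combination a * h2 + i2 * (d - a) * huv
    · linear_combination b * h2 - i2 * (b + c) * huv
    · linear_combination c * h2 - i2 * (b + c) * huv
    · linear_combination d * h2 - i2 * (d - a) * huv

end count

lemma isUnit_iff_not_dvd (p : ℕ) (hp : p.Prime) (n : ℕ) (x : ZMod (p ^ (n + 1))) :
    IsUnit x ↔ ¬ (p : ZMod (p ^ (n + 1))) ∣ x := by
  haveI := Fact.mk hp
  haveI : NeZero (p ^ (n + 1)) := ⟨pow_ne_zero _ hp.ne_zero⟩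
  have hpu : ¬ IsUnit (p : ZMod (p ^ (n + 1))) := by
    rw [ZMod.isUnit_iff_coprime, Nat.coprime_pow_right_iff (Nat.succ_pos n), Nat.coprime_self]
    exact hp.one_lt.ne'
  constructor
  · intro h hd
    exact hpu (isUnit_of_dvd_unit hd h)
  · intro h
    rw [← ZMod.natCast_zmod_val x] at h ⊢
    rw [ZMod.isUnit_iff_coprime]
    apply Nat.Coprime.pow_right
    rw [Nat.coprime_comm, hp.coprime_iff_not_dvd]
    rintro ⟨k, hk⟩
    exact h ⟨k, by rw [hk]; push_cast; rfl⟩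

lemma card_main (p : ℕ) (hp : p.Prime) (hodd : p ≠ 2)
    (m : ℤ) (hm : (p : ℤ) ∣ m) (hm' : ¬ (p : ℤ) ^ 2 ∣ m) (n : ℕ) :
    Nat.card {x : Fin 4 → ZMod (p ^ (n + 2)) //
              (∑ i, x i ^ 2) = (m : ZMod (p ^ (n + 2)))}
      = p ^ (n + 1) * (p - 1) * (p ^ (n + 2) + p ^ (n + 1)) ^ 2 := by
  classical
  haveI := Fact.mk hp
  haveI : NeZero (p ^ (n + 2)) := ⟨pow_ne_zero _ hp.ne_zero⟩
  obtain ⟨a, b, -, hab⟩ := exists_sq_add_sq p hp hodd (n + 1)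
  have huv : (a : ZMod (p ^ (n + 2))) ^ 2 + (b : ZMod (p ^ (n + 2))) ^ 2 = -1 := by
    have : ((a ^ 2 + b ^ 2 + 1 : ℤ) : ZMod (p ^ (n + 2))) = 0 := by
      rw [ZMod.intCast_zmod_eq_zero_iff_dvd]
      exact_mod_cast hab
    push_cast at this
    linear_combination this
  have h2 : IsUnit ((2 : ℕ) : ZMod (p ^ (n + 2))) := by
    rw [ZMod.isUnit_iff_coprime]
    exact Nat.Coprime.pow_right _ ((Nat.coprime_primes Nat.prime_two hp).mpr hodd.symm)
  obtain ⟨i2, hi2⟩ := h2.exists_right_inv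
  have iu := isUnit_iff_not_dvd p hp (n + 1)
  rw [card_four_sq _ _ _ i2 huv (by exact_mod_cast hi2),
    card_det _ (Finset.univ.filter fun x => IsUnit x) (Finset.univ.filter fun x => ¬ IsUnit x)
      (by simp) (by simp)]
  · have hU : (Finset.univ.filter fun x : ZMod (p ^ (n + 2)) => IsUnit x).card
        = p ^ (n + 1) * (p - 1) := by
      have h := ZMod.card_units_eq_totient (p ^ (n + 2))
      rw [Nat.totient_prime_pow_succ hp] at h
      rw [← h, ← Finset.card_univ]
      symm
      refine Finset.card_bij (fun x _ => (x : ZMod (p ^ (n + 2)))) ?_ ?_ ?_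
      · intro x _
        simp
      · intro x _ y _ h
        exact Units.ext h
      · intro x hx
        simp at hx
        exact ⟨hx.unit, by simp, rfl⟩
    have hN := Finset.card_filter_add_card_filter_not
      (s := (Finset.univ : Finset (ZMod (p ^ (n + 2))))) (fun x => IsUnit x)
    rw [hU, Finset.card_univ, ZMod.card] at hN
    have hq : (Finset.univ.filter fun x : ZMod (p ^ (n + 2)) => ¬ IsUnit x).card
        = p ^ (n + 1) := by
      obtain ⟨k, rfl⟩ : ∃ k, p = k + 1 := ⟨p - 1, by have := hp.pos; omega⟩
      have : (k + 1) ^ (n + 2) = (k + 1) ^ (n + 1) * (k + 1 - 1) + (k + 1) ^ (n + 1) := by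
        simp; ring
      omega
    rw [hU, hq, ZMod.card]
  · intro x y hx hy
    rw [iu, not_not] at *
    exact dvd_add hx hy
  · rw [iu, not_not]
    obtain ⟨k, rfl⟩ := hm
    exact ⟨k, by push_cast; rfl⟩
  · intro a b c d ha hb hc hd h
    rw [iu, not_not] at *
    obtain ⟨a, rfl⟩ := ha
    obtain ⟨b, rfl⟩ := hb
    obtain ⟨c, rfl⟩ := hc
    obtain ⟨d, rfl⟩ := hd
    obtain ⟨k, hk⟩ := ZMod.intCast_surjective (a * d - b * c)
    have : ((m - p ^ 2 * k : ℤ) : ZMod (p ^ (n + 2))) = 0 := by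
      push_cast
      rw [hk, ← h]
      ring
    rw [ZMod.intCast_zmod_eq_zero_iff_dvd] at this
    push_cast at this
    have h3 : (p : ℤ) ^ 2 ∣ m - p ^ 2 * k := (pow_dvd_pow _ (by omega)).trans this
    exact hm' ((dvd_sub_left (Dvd.intro _ rfl)).mp h3)

/-- for `p` an odd prime and `m` with `ord_p(m) = 1`, the local
density `β_p(m) = lim_ν r_{p^ν}(m)/p^{3ν}` of the sum of four squares exists
and satisfies `β_p(m)·p²/(p²-1) = 1 + 1/p`. -/
theorem local_density_ord_one (p : ℕ) (hp : p.Prime) (hodd : p ≠ 2)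
    (m : ℤ) (hm : (p : ℤ) ∣ m) (hm' : ¬ (p : ℤ) ^ 2 ∣ m) :
    ∃ β : ℝ,
      Tendsto (fun ν : ℕ =>
          (Nat.card {x : Fin 4 → ZMod (p ^ ν) //
              (∑ i, x i ^ 2) = (m : ZMod (p ^ ν))} : ℝ) / (p : ℝ) ^ (3 * ν))
        atTop (nhds β) ∧
      β * (p : ℝ) ^ 2 / ((p : ℝ) ^ 2 - 1) = 1 + 1 / (p : ℝ) := by
  have hp1 : (1 : ℝ) < p := by exact_mod_cast hp.one_lt
  have hp0 : (p : ℝ) ≠ 0 := by positivity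
  refine ⟨((p : ℝ) - 1) * (p + 1) ^ 2 / p ^ 3, ?_, ?_⟩
  · rw [← tendsto_add_atTop_iff_nat 2]
    refine tendsto_const_nhds.congr fun n => ?_
    rw [card_main p hp hodd m hm hm' n]
    push_cast [Nat.cast_sub hp.one_lt.le]
    field_simp
    ring
  · have : (p : ℝ) ^ 2 - 1 ≠ 0 := by nlinarith
    field_simp
    ring
end
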